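/- arXiv:1705.03195 — 3 statements merged into one kernel-verified Lean document; each statement's English description precedes it below -/
import Mathlib

section
/- If G is a finite simple graph with maximum degree Δ(G) ≥ 9 that contains no induced subgraph isomorphic to the disjoint union P₃ ∪ K₁ (a path on three vertices together with an isolated vertex), then the chromatic number of G satisfies χ(G) ≤ max{ω(G), Δ(G) − 1}, where ω(G) is the clique number of G. -/
open SimpleGraph

/-- The graph `H = P₃ ∪ K₁`: a path 0–1–2 together with the isolated vertex 3. -/
def graphH : SimpleGraph (Fin 4) := SimpleGraph.fromEdgeSet {s(0, 1), s(1, 2)}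

/-- The graph `R = K₂ ∪ 2K₁`: the edge 0–1 together with the isolated vertices 2 and 3. -/
def graphR : SimpleGraph (Fin 4) := SimpleGraph.fromEdgeSet {s(0, 1)}

/-- `G` contains no induced subgraph isomorphic to `F`
(graph embeddings are exactly induced-subgraph copies). -/
def IndFree {α : Type*} {V : Type*} (F : SimpleGraph α) (G : SimpleGraph V) : Prop :=
  IsEmpty (F ↪g G)

/-- Maximum degree `Δ(G)` (with classical decidability of adjacency). -/
noncomputable def maxDeg {V : Type*} [Fintype V] (G : SimpleGraph V) : ℕ := by
  classical exact G.maxDegree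

/-- Degree of a vertex (with classical decidability of adjacency). -/
noncomputable def deg {V : Type*} [Fintype V] (G : SimpleGraph V) (v : V) : ℕ := by
  classical exact G.degree v

structure IsPartialMatching {V : Type*} (T : SimpleGraph V) (f : V → V) : Prop where
  invol : ∀ v, f (f v) = v
  adj : ∀ v, f v ≠ v → T.Adj v (f v)

/-- The vertices missed by the matching that the involution `f` encodes. -/
noncomputable def exposed {V : Type*} [Fintype V] (f : V → V) : Finset V := by
  classical exact Finset.univ.filter fun v => f v = v

structure IsMaxPartialMatching {V : Type*} [Fintype V] (T : SimpleGraph V) (f : V → V) : Prop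
    extends IsPartialMatching T f where
  card_le : ∀ g, IsPartialMatching T g → (exposed f).card ≤ (exposed g).card

lemma mem_exposed {V : Type*} [Fintype V] {f : V → V} {v : V} : v ∈ exposed f ↔ f v = v := by
  classical simp [exposed]

lemma exists_isMaxPartialMatching {V : Type*} [Fintype V] (T : SimpleGraph V) :
    ∃ f, IsMaxPartialMatching T f := by
  have hne : {f : V → V | IsPartialMatching T f}.Nonempty := ⟨id, by simp, by simp⟩
  obtain ⟨f, hf, hmin⟩ := (Set.toFinite _).exists_minimalFor (fun f => (exposed f).card) _ hne
  exact ⟨f, hf, fun g hg => (le_total _ _).elim id (hmin hg)⟩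

section MaxMatching

variable {V : Type*} [Fintype V] {T : SimpleGraph V} {f : V → V}

lemma IsMaxPartialMatching.not_adj (hf : IsMaxPartialMatching T f) {u v : V}
    (hu : f u = u) (hv : f v = v) : ¬ T.Adj u v := by
  classical
  intro h
  have hne := h.ne
  have hsymm := h.symm
  have hi := hf.invol
  have ha := hf.adj
  have key := hf.card_le (fun w => if w = u then v else if w = v then u else f w)
    ⟨fun w => by grind, fun w => by grind⟩
  refine absurd key (not_le.mpr (Finset.card_lt_card ?_))
  refine Finset.ssubset_iff_subset_ne.mpr ⟨fun w => ?_, fun heq => ?_⟩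
  · simp only [mem_exposed]; grind
  · have := (mem_exposed (f := f)).mpr hu
    rw [← heq, mem_exposed] at this
    simp at this; exact hne this.symm

/-- Exchanging the matching edge `x — f x` for the edge `u — x`. -/
lemma IsMaxPartialMatching.exchange (hf : IsMaxPartialMatching T f) {u x : V}
    (hu : f u = u) (h : T.Adj u x) :
    ∃ g, IsMaxPartialMatching T g ∧ g (f x) = f x ∧
      ∀ w, w ≠ u → w ≠ x → w ≠ f x → g w = f w := by
  classical
  have hx : f x ≠ x := fun hx => hf.not_adj hu hx h
  have hne := h.ne
  have hsymm := h.symm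
  have hi := hf.invol
  have ha := hf.adj
  set g : V → V := fun w => if w = u then x else if w = x then u else if w = f x then w else f w
    with hg
  have hgm : IsPartialMatching T g := ⟨fun w => by grind, fun w => by grind⟩
  refine ⟨g, ⟨hgm, fun g' hg' => le_trans ?_ (hf.card_le g' hg')⟩, by grind, by grind⟩
  have hsub : exposed g ⊆ insert (f x) ((exposed f).erase u) := by
    intro w
    simp only [mem_exposed, Finset.mem_insert, Finset.mem_erase]
    grind
  have h1 := Finset.card_le_card hsub
  have h2 := Finset.card_insert_le (f x) ((exposed f).erase u)
  have h3 := Finset.card_erase_add_one ((mem_exposed (f := f)).mpr hu)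
  omega

lemma two_mul_card_le_of_disjoint_image (hi : ∀ v, f (f v) = v) (X : Finset V)
    (hX : ∀ x ∈ X, f x ∉ X) : 2 * X.card + (exposed f).card ≤ Fintype.card V := by
  classical
  have hinj : Function.Injective f := fun a b h => by rw [← hi a, h, hi]
  have hd : Disjoint X (X.image f) := by
    rw [Finset.disjoint_left]
    intro a ha hb
    obtain ⟨b, hbX, rfl⟩ := Finset.mem_image.mp hb
    exact hX b hbX ha
  have hd' : Disjoint (X ∪ X.image f) (exposed f) := by
    rw [Finset.disjoint_left]
    intro a ha hb
    rw [mem_exposed] at hb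
    simp only [Finset.mem_union, Finset.mem_image] at ha
    grind
  have := Finset.card_le_univ ((X ∪ X.image f) ∪ exposed f)
  rw [Finset.card_union_of_disjoint hd', Finset.card_union_of_disjoint hd,
    Finset.card_image_of_injective _ hinj] at this
  omega

/-- An exposed vertex of large degree is adjacent to an end of all matching edges but one. -/
lemma IsMaxPartialMatching.eq_or_eq_of_not_adj (hf : IsMaxPartialMatching T f)
    (htri : ∀ a b c, T.Adj a b → T.Adj b c → ¬ T.Adj a c) {k : ℕ}
    (hdeg : ∀ v, Fintype.card V ≤ {w | T.Adj v w}.ncard + 1 + k)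
    (hexp : 2 * k ≤ Fintype.card V + (exposed f).card) {u v w : V} (hu : f u = u)
    (hv : f v ≠ v) (hw : f w ≠ w) (huv : ¬ T.Adj u v) (hufv : ¬ T.Adj u (f v))
    (huw : ¬ T.Adj u w) (hufw : ¬ T.Adj u (f w)) : w = v ∨ w = f v := by
  classical
  by_contra! hne
  have hi := hf.invol
  have ha := hf.adj
  have hnu := fun x => hf.not_adj (u := u) (v := x) hu
  have h1 := two_mul_card_le_of_disjoint_image hi
    (insert v (insert w (Finset.univ.filter fun x => T.Adj u x))) (by
      intro x
      simp only [Finset.mem_insert, Finset.mem_filter, Finset.mem_univ, true_and]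
      have := htri u x (f x)
      grind)
  rw [Finset.card_insert_of_notMem (by simp [hne.1.symm, huv]),
    Finset.card_insert_of_notMem (by simp [huw])] at h1
  have h2 := hdeg u
  rw [Set.ncard_eq_toFinset_card', Set.toFinset_ofPred] at h2
  convert_to _ ≤ (Finset.univ.filter fun x => T.Adj u x).card + 1 + k at h2
  omega

/-- Vertices that are ends of an edge of the graph at an exposed vertex. -/
def IsHit (T : SimpleGraph V) (f : V → V) (x : V) : Prop := ∃ u, f u = u ∧ T.Adj u x

lemma IsMaxPartialMatching.not_isHit_apply (hf : IsMaxPartialMatching T f)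
    (htri : ∀ a b c, T.Adj a b → T.Adj b c → ¬ T.Adj a c) {x : V} (hx : IsHit T f x) :
    ¬ IsHit T f (f x) := by
  rintro ⟨u', hu', h'⟩
  obtain ⟨u, hu, h⟩ := hx
  have hx : f x ≠ x := fun hx => hf.not_adj hu hx h
  have hxx := hf.adj x hx
  have hi := hf.invol
  by_cases huu : u' = u
  · subst huu
    exact htri _ _ _ h hxx h'
  · obtain ⟨g, hg, hgx, hgw⟩ := hf.exchange hu h
    refine hg.not_adj (u := u') ?_ hgx h'
    rw [hgw u' huu, hu'] <;> grind

lemma IsMaxPartialMatching.not_adj_of_distinct (hf : IsMaxPartialMatching T f)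
    (htri : ∀ a b c, T.Adj a b → T.Adj b c → ¬ T.Adj a c) {u u' v w : V}
    (hu : f u = u) (hu' : f u' = u') (huu : u ≠ u')
    (huv : T.Adj u (f v)) (huw : T.Adj u' (f w)) : ¬ T.Adj v w := by
  intro hvw
  have hi := hf.invol
  have hv : f v ≠ v := fun h => hf.not_adj hu (by rw [hi, h]) huv
  have hw : f w ≠ w := fun h => hf.not_adj hu' (by rw [hi, h]) huw
  have hvw' : w ≠ f v := by
    rintro rfl
    exact hf.not_isHit_apply htri ⟨u, hu, huv⟩ ⟨u', hu', huw⟩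
  have hne := hvw.ne
  obtain ⟨g, hg, hgv, hgo⟩ := hf.exchange hu huv
  rw [hi] at hgv hgo
  have hgu' : g u' = u' := by rw [hgo] <;> grind
  have hgw : g (f w) = w := by rw [hgo] <;> grind
  obtain ⟨g₂, hg₂, hgw₂, hgo₂⟩ := hg.exchange hgu' huw
  rw [hgw] at hgw₂ hgo₂
  refine hg₂.not_adj ?_ hgw₂ hvw
  rw [hgo₂] <;> grind

/-- Two exposed vertices make the unhit partners of hit vertices an independent set. -/
lemma IsMaxPartialMatching.not_adj_of_isHit_apply (hf : IsMaxPartialMatching T f)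
    (htri : ∀ a b c, T.Adj a b → T.Adj b c → ¬ T.Adj a c) {k : ℕ}
    (hdeg : ∀ v, Fintype.card V ≤ {w | T.Adj v w}.ncard + 1 + k)
    (hexp : 2 * k ≤ Fintype.card V + (exposed f).card) (htwo : 2 ≤ (exposed f).card) {v w : V}
    (hv : ¬ IsHit T f v) (hw : ¬ IsHit T f w)
    (hv' : IsHit T f (f v)) (hw' : IsHit T f (f w)) : ¬ T.Adj v w := by
  intro hvw
  obtain ⟨u, hu, huv⟩ := hv'
  obtain ⟨u', hu', huw⟩ := hw'
  by_cases huu : u = u'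
  · subst huu
    obtain ⟨z, hz, hzu⟩ := Finset.exists_mem_ne htwo u
    rw [mem_exposed] at hz
    have h1 : ¬ T.Adj z (f v) := fun h =>
      hf.not_adj_of_distinct htri hz hu hzu h huw hvw
    have h2 : ¬ T.Adj z (f w) := fun h =>
      hf.not_adj_of_distinct htri hu hz hzu.symm huv h hvw
    have hi := hf.invol
    have hv0 : f v ≠ v := fun h => hf.not_adj hu (by rw [hi, h]) huv
    have hw0 : f w ≠ w := fun h => hf.not_adj hu (by rw [hi, h]) huw
    rcases hf.eq_or_eq_of_not_adj htri hdeg hexp hz hv0 hw0 (fun h => hv ⟨z, hz, h⟩) h1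
      (fun h => hw ⟨z, hz, h⟩) h2 with h | h
    · exact hvw.ne h.symm
    · exact hw ⟨u, hu, h ▸ huv⟩
  · exact hf.not_adj_of_distinct htri hu hu' huu huv huw hvw

/-- In a triangle-free graph of large minimum degree, a maximum matching that misses at least two
vertices comes with a vertex cover picking at most one end of each matching edge. -/
lemma IsMaxPartialMatching.exists_cover (hf : IsMaxPartialMatching T f)
    (htri : ∀ a b c, T.Adj a b → T.Adj b c → ¬ T.Adj a c) {k : ℕ}
    (hdeg : ∀ v, Fintype.card V ≤ {w | T.Adj v w}.ncard + 1 + k)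
    (hexp : 2 * k ≤ Fintype.card V + (exposed f).card) (htwo : 2 ≤ (exposed f).card) :
    ∃ X : Finset V, (∀ x ∈ X, f x ∉ X) ∧ ∀ v w, v ∉ X → w ∉ X → ¬ T.Adj v w := by
  classical
  have hi := hf.invol
  have hhit : ∀ x, IsHit T f x → ¬ IsHit T f (f x) := fun x => hf.not_isHit_apply htri
  by_cases hall : ∀ v, f v ≠ v → ¬ IsHit T f v → IsHit T f (f v)
  · refine ⟨Finset.univ.filter (IsHit T f), by simpa using hhit, fun v w hv hw hvw => ?_⟩
    simp only [Finset.mem_filter, Finset.mem_univ, true_and] at hv hw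
    have hv0 : f v ≠ v := fun h => hw ⟨v, h, hvw⟩
    have hw0 : f w ≠ w := fun h => hv ⟨w, h, hvw.symm⟩
    exact hf.not_adj_of_isHit_apply htri hdeg hexp htwo hv hw (hall v hv0 hv) (hall w hw0 hw) hvw
  · push Not at hall
    obtain ⟨a, ha0, ha, hfa⟩ := hall
    have haa := hf.adj a ha0
    have hadj : ∀ u w, f u = u → f w ≠ w → w ≠ a → w ≠ f a → ¬ IsHit T f w → T.Adj u (f w) := by
      intro u w hu hw0 hwa hwfa hw
      by_contra h
      rcases hf.eq_or_eq_of_not_adj htri hdeg hexp hu ha0 hw0 (fun h => ha ⟨u, hu, h⟩)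
        (fun h => hfa ⟨u, hu, h⟩) (fun h => hw ⟨u, hu, h⟩) h with h | h
      exacts [hwa h, hwfa h]
    obtain ⟨u, hu, u', hu', huu⟩ := Finset.one_lt_card.mp htwo
    rw [mem_exposed] at hu hu'
    have hY : ∀ v w, ¬ IsHit T f v → ¬ IsHit T f w → v ≠ a → v ≠ f a → w ≠ a → w ≠ f a →
        ¬ T.Adj v w := by
      intro v w hv hw hva hvfa hwa hwfa hvw
      have hv0 : f v ≠ v := fun h => hw ⟨v, h, hvw⟩
      have hw0 : f w ≠ w := fun h => hv ⟨w, h, hvw.symm⟩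
      exact hf.not_adj_of_isHit_apply htri hdeg hexp htwo hv hw
        ⟨u, hu, hadj u v hu hv0 hva hvfa hv⟩ ⟨u, hu, hadj u w hu hw0 hwa hwfa hw⟩ hvw
    have hend : (∀ y, ¬ IsHit T f y → y ≠ f a → ¬ T.Adj a y) ∨
        (∀ y, ¬ IsHit T f y → y ≠ a → ¬ T.Adj (f a) y) := by
      by_contra! hcon
      obtain ⟨⟨y, hy, hyfa, hay⟩, z, hz, hza, haz⟩ := hcon
      have hya := hay.ne
      have hzfa := haz.ne
      have hy0 : f y ≠ y := fun h => ha ⟨y, h, hay.symm⟩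
      have hz0 : f z ≠ z := fun h => hfa ⟨z, h, haz.symm⟩
      have hyz : y ≠ z := by
        rintro rfl
        exact htri _ _ _ haa haz hay
      have huy := hadj u y hu hy0 hya.symm hyfa hy
      have huz := hadj u' z hu' hz0 hza hzfa.symm hz
      have hzfy : z ≠ f y := by
        rintro rfl
        exact hz ⟨u, hu, huy⟩
      obtain ⟨g, hg, hgy, hgo⟩ := hf.exchange hu huy
      rw [hi] at hgy hgo
      have hga : g a = f a := by rw [hgo] <;> grind
      obtain ⟨g₂, hg₂, hga₂, hgo₂⟩ := hg.exchange hgy hay.symm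
      rw [hga] at hga₂ hgo₂
      have hu'₂ : g₂ u' = u' := by rw [hgo₂, hgo] <;> clear htri hY hadj hdeg hhit hgo hgo₂ <;> grind
      have hz₂ : g₂ (f z) = z := by rw [hgo₂, hgo] <;> clear htri hY hadj hdeg hhit hgo hgo₂ <;> grind
      obtain ⟨g₃, hg₃, hgz₃, hgo₃⟩ := hg₂.exchange hu'₂ huz
      rw [hz₂] at hgz₃ hgo₃
      refine hg₃.not_adj (u := f a) ?_ hgz₃ haz
      rw [hgo₃] <;> clear htri hY hadj hdeg hhit hgo hgo₂ hgo₃ <;> grind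
    rcases hend with h | h
    · refine ⟨insert (f a) (Finset.univ.filter (IsHit T f)), ?_, fun v w hv hw hvw => ?_⟩
      · simp only [Finset.mem_insert, Finset.mem_filter, Finset.mem_univ, true_and]
        clear htri hY hadj hdeg h
        grind
      · simp only [Finset.mem_insert, Finset.mem_filter, Finset.mem_univ, true_and, not_or] at hv hw
        by_cases hva : v = a
        · exact h w hw.2 hw.1 (hva ▸ hvw)
        by_cases hwa : w = a
        · exact h v hv.2 hv.1 (hwa ▸ hvw.symm)
        exact hY v w hv.2 hw.2 hva hv.1 hwa hw.1 hvw
    · refine ⟨insert (a) (Finset.univ.filter (IsHit T f)), ?_, fun v w hv hw hvw => ?_⟩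
      · simp only [Finset.mem_insert, Finset.mem_filter, Finset.mem_univ, true_and]
        clear htri hY hadj hdeg h
        grind
      · simp only [Finset.mem_insert, Finset.mem_filter, Finset.mem_univ, true_and, not_or] at hv hw
        by_cases hva : v = f a
        · exact h w hw.2 hw.1 (hva ▸ hvw)
        by_cases hwa : w = f a
        · exact h v hv.2 hv.1 (hwa ▸ hvw.symm)
        exact hY v w hv.2 hw.2 hv.1 hva hw.1 hwa hvw

/-- Colour each vertex by the matching edge or exposed vertex it belongs to. -/
lemma IsPartialMatching.colorable_compl (hf : IsPartialMatching T f) {m : ℕ}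
    (hm : Fintype.card V + (exposed f).card ≤ 2 * m) : Tᶜ.Colorable m := by
  classical
  have hi := hf.invol
  let c : V → Finset V := fun v => {v, f v}
  have hc : ∀ v w, c v = c w ↔ w = v ∨ w = f v := by
    intro v w
    constructor
    · intro h
      have : w ∈ c v := by rw [h]; simp [c]
      simpa [c] using this
    · rintro (rfl | rfl)
      · rfl
      · simp only [c, hi, Finset.pair_comm]
  have hcard : 2 * (Finset.univ.image c).card ≤ Fintype.card V + (exposed f).card := by
    rw [← Finset.card_univ, Finset.card_eq_sum_card_image c Finset.univ,
      Finset.card_eq_sum_card_fiberwise (f := c) (s := exposed f) (t := Finset.univ.image c)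
        (fun x _ => by simp),
      ← Finset.sum_add_distrib, mul_comm, ← smul_eq_mul]
    refine Finset.card_nsmul_le_sum _ _ _ fun b hb => ?_
    obtain ⟨v, -, rfl⟩ := Finset.mem_image.mp hb
    by_cases hv : f v = v
    · have h1 : 0 < (Finset.univ.filter fun a => c a = c v).card :=
        Finset.card_pos.mpr ⟨v, by simp⟩
      have h2 : 0 < ((exposed f).filter fun a => c a = c v).card :=
        Finset.card_pos.mpr ⟨v, by simp [mem_exposed, hv]⟩
      omega
    · have h1 : 1 < (Finset.univ.filter fun a => c a = c v).card :=
        Finset.one_lt_card.mpr ⟨v, by simp, f v, by simp [hc, hi], Ne.symm hv⟩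
      omega
  let col : Tᶜ.Coloring (Finset.univ.image c) :=
    Coloring.mk (fun v => ⟨c v, by simp⟩) (by
      intro v w hvw heq
      rw [compl_adj] at hvw
      have := (hc v w).mp (congrArg Subtype.val heq)
      have := hf.adj v
      grind)
  refine col.colorable.mono ?_
  rw [Fintype.card_coe]
  omega

end MaxMatching

lemma IsPartialMatching.card_modEq {V : Type*} [Fintype V] {T : SimpleGraph V} {f : V → V}
    (hf : IsPartialMatching T f) : Fintype.card V ≡ (exposed f).card [MOD 2] := by
  classical
  have h := Equiv.Perm.card_fixedPoints_modEq (f := (f : Function.End V)) (p := 2) (n := 1)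
    (by funext v; exact hf.invol v)
  rwa [Fintype.card_of_subtype (p := fun v => v ∈ Function.fixedPoints f) (exposed f)
    fun v => mem_exposed] at h

lemma ncard_adj_eq_degree {V : Type*} [Fintype V] (G : SimpleGraph V) [DecidableRel G.Adj] (v : V) :
    {w | G.Adj v w}.ncard = G.degree v := by
  rw [← card_neighborSet_eq_degree, ← Nat.card_eq_fintype_card]
  rfl

lemma ncard_compl_adj {V : Type*} [Fintype V] (G : SimpleGraph V) (v : V) :
    {w | Gᶜ.Adj v w}.ncard + {w | G.Adj v w}.ncard + 1 = Fintype.card V := by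
  classical
  have h1 := G.degree_compl v
  have h2 := G.degree_lt_card_verts v
  have h3 : {w | Gᶜ.Adj v w}.ncard = Gᶜ.degree v := ncard_adj_eq_degree Gᶜ v
  have h4 : {w | G.Adj v w}.ncard = G.degree v := ncard_adj_eq_degree G v
  omega

/-- Borodin–Kostochka for graphs without three pairwise nonadjacent vertices. -/
lemma colorable_of_compl_triangleFree {V : Type*} [Fintype V] (G : SimpleGraph V) {k : ℕ}
    (hk : 9 ≤ k) (htri : ∀ a b c, Gᶜ.Adj a b → Gᶜ.Adj b c → ¬ Gᶜ.Adj a c)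
    (hdeg : ∀ v, {w | G.Adj v w}.ncard ≤ k) (hω : G.cliqueNum < k) : G.Colorable (k - 1) := by
  classical
  have hcl : ∀ s : Finset V, (∀ v w, v ∈ s → w ∈ s → ¬ Gᶜ.Adj v w) → s.card < k := by
    intro s hs
    have : G.IsClique s := by
      intro v hv w hw hvw
      have := hs v w hv hw
      rw [compl_adj] at this
      tauto
    exact lt_of_le_of_lt this.card_le_cliqueNum hω
  have hcodeg : ∀ v, Fintype.card V ≤ {w | Gᶜ.Adj v w}.ncard + 1 + k := by
    intro v
    have h1 := ncard_compl_adj G v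
    have h2 := hdeg v
    omega
  by_contra hcol
  rcases lt_or_ge (Fintype.card V) (2 * k - 1) with hn | hn
  · obtain ⟨f, hf⟩ := exists_isMaxPartialMatching Gᶜ
    have hpar := hf.card_modEq
    have hexp : 2 * (k - 1) < Fintype.card V + (exposed f).card := by
      by_contra! h
      exact hcol (by simpa using hf.colorable_compl h)
    unfold Nat.ModEq at hpar
    obtain ⟨X, hX, hXc⟩ := hf.exists_cover htri (k := k) hcodeg (by omega) (by omega)
    have h1 := two_mul_card_le_of_disjoint_image hf.invol X hX
    have h2 := hcl (Finset.univ \ X) fun v w hv hw => hXc v w (by simpa using hv) (by simpa using hw)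
    rw [Finset.card_sdiff_of_subset (Finset.subset_univ X), Finset.card_univ] at h2
    omega
  · have : Nonempty V := Fintype.card_pos_iff.mp (by omega)
    have hfree : Gᶜ.CliqueFree (2 + 1) := by
      intro s hs
      obtain ⟨a, b, c, hab, hac, hbc, -⟩ := is3Clique_iff.mp hs
      exact htri a b c hab hbc hac
    have hmin : Fintype.card V - 1 - k ≤ Gᶜ.minDegree := by
      refine le_minDegree_of_forall_le_degree _ _ fun v => ?_
      have h1 := hcodeg v
      rw [ncard_adj_eq_degree] at h1
      omega
    obtain ⟨c⟩ := colorable_of_cliqueFree_lt_minDegree hfree (by omega)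
    have hclass : ∀ i, (Finset.univ.filter fun v => c v = i).card < k := by
      refine fun i => hcl _ fun v w hv hw hvw => c.valid hvw ?_
      simp only [Finset.mem_filter, Finset.mem_univ, true_and] at hv hw
      rw [hv, hw]
    have hsum := Finset.card_eq_sum_card_fiberwise (f := c) (s := Finset.univ)
      (t := Finset.univ) (fun x _ => by simp)
    rw [Fin.sum_univ_two, Finset.card_univ] at hsum
    have h0 := hclass 0
    have h1 := hclass 1
    omega

/-- If every neighbour of the clique `A` outside `A` is adjacent to the whole of a clique `B` at
least as large as `A`, the colours of `B` can be reused on `A`. -/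
lemma colorable_of_induce_compl {V : Type*} {G : SimpleGraph V} {A B : Finset V}
    (hB : G.IsClique B) (hAB : Disjoint A B) (hcard : A.card ≤ B.card)
    (hadj : ∀ d ∈ A, ∀ w ∉ A, G.Adj d w → ∀ e ∈ B, G.Adj w e) {m : ℕ}
    (hm : (G.induce {v | v ∉ A}).Colorable m) : G.Colorable m := by
  classical
  obtain ⟨c⟩ := hm
  have hBA : ∀ e ∈ B, e ∉ A := fun e he hA => Finset.disjoint_left.mp hAB hA he
  obtain ⟨e⟩ : Nonempty (A ↪ B) := Function.Embedding.nonempty_of_card_le (by simpa using hcard)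
  let col : V → Fin m := fun v =>
    if h : v ∈ A then c ⟨e ⟨v, h⟩, hBA _ (e ⟨v, h⟩).2⟩ else c ⟨v, h⟩
  have hmix : ∀ v w, v ∈ A → w ∉ A → G.Adj v w → col v ≠ col w := by
    intro v w hv hw hvw
    simp only [col, hv, hw, dif_pos, dif_neg, not_false_eq_true]
    exact c.valid (hadj v hv w hw hvw _ (e ⟨v, hv⟩).2).symm
  refine ⟨Coloring.mk col fun {v w} hvw => ?_⟩
  by_cases hv : v ∈ A <;> by_cases hw : w ∈ A
  · simp only [col, hv, hw, dif_pos]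
    refine c.valid (hB (e ⟨v, hv⟩).2 (e ⟨w, hw⟩).2 fun h => hvw.ne ?_)
    simpa using e.injective (Subtype.ext h)
  · exact hmix v w hv hw hvw
  · exact (hmix w v hw hv hvw.symm).symm
  · simp only [col, hv, hw, dif_neg, not_false_eq_true]
    exact c.valid hvw

/-- `G` has no induced path `a — b — c` together with a vertex `d` adjacent to none of them. -/
def NoPathPlusPoint {V : Type*} (G : SimpleGraph V) : Prop :=
  ∀ a b c d, G.Adj a b → G.Adj b c → a ≠ c → ¬ G.Adj a c → d ≠ a → d ≠ b → d ≠ c →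
    ¬ G.Adj a d → ¬ G.Adj b d → ¬ G.Adj c d → False

lemma noPathPlusPoint_of_indFree {V : Type*} {G : SimpleGraph V} (h : IndFree graphH G) :
    NoPathPlusPoint G := by
  intro a b c d hab hbc hac hnac hda hdb hdc had hbd hcd
  have hba := hab.symm
  have hcb := hbc.symm
  refine h.elim ⟨⟨![a, b, c, d], ?_⟩, ?_⟩
  · intro i j
    have h1 := hab.ne
    have h2 := hbc.ne
    fin_cases i <;> fin_cases j <;> simp <;> grind
  · intro i j
    change G.Adj (![a, b, c, d] i) (![a, b, c, d] j) ↔ _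
    have h1 := G.adj_comm a c
    have h2 := G.adj_comm a d
    have h3 := G.adj_comm b d
    have h4 := G.adj_comm c d
    fin_cases i <;> fin_cases j <;> simp [graphH] <;> grind

/-- The clique of vertices of `G` attached to `a` but not to `b` or `c`. -/
noncomputable def attached {V : Type*} [Fintype V] (G : SimpleGraph V) (a b c : V) : Finset V := by
  classical exact Finset.univ.filter fun v => (v = a ∨ G.Adj v a) ∧ ¬ G.Adj v b ∧ ¬ G.Adj v c

lemma mem_attached {V : Type*} [Fintype V] {G : SimpleGraph V} {a b c v : V} :
    v ∈ attached G a b c ↔ (v = a ∨ G.Adj v a) ∧ ¬ G.Adj v b ∧ ¬ G.Adj v c := by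
  classical simp [attached]

lemma NoPathPlusPoint.isClique_attached {V : Type*} [Fintype V] {G : SimpleGraph V}
    (hG : NoPathPlusPoint G) {a b c : V} (hab : a ≠ b) (hnab : ¬ G.Adj a b) :
    G.IsClique (attached G a b c : Set V) := by
  intro v hv w hw hvw
  simp only [Finset.mem_coe, mem_attached] at hv hw
  have hne : ∀ x, (x = a ∨ G.Adj x a) → b ≠ x := by
    rintro x hx rfl
    rcases hx with h | h
    exacts [hab h.symm, hnab h.symm]
  rcases hv.1 with rfl | hva
  · rcases hw.1 with rfl | hwv
    exacts [absurd rfl hvw, hwv.symm]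
  · rcases hw.1 with rfl | hwa
    · exact hva
    · by_contra h
      exact hG v a w b hva hwa.symm hvw h (hne v hv.1) hab.symm (hne w hw.1) hv.2.1 hnab hw.2.1

lemma NoPathPlusPoint.colorable_of_card_attached_le {V : Type*} [Fintype V] {G : SimpleGraph V}
    (hG : NoPathPlusPoint G) {a b c : V} (hab : a ≠ b) (hac : a ≠ c) (hbc : b ≠ c)
    (hnab : ¬ G.Adj a b) (hnac : ¬ G.Adj a c) (hnbc : ¬ G.Adj b c)
    (hcard : (attached G a b c).card ≤ (attached G b a c).card) {m : ℕ}
    (hm : (G.induce {v | v ∉ attached G a b c}).Colorable m) : G.Colorable m := by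
  refine colorable_of_induce_compl (hG.isClique_attached hab.symm fun h => hnab h.symm) ?_ hcard
    ?_ hm
  · rw [Finset.disjoint_left]
    intro v hv hv'
    rw [mem_attached] at hv hv'
    have := G.adj_comm a b
    grind
  · intro d hd w hw hdw e he
    rw [mem_attached] at hd hw he
    obtain ⟨hda, hdb, hdc⟩ := hd
    obtain ⟨heb, hea, hec⟩ := he
    have hba : ¬ G.Adj b a := fun h => hnab h.symm
    have hwa0 : w ≠ a := by
      rintro rfl
      exact hw ⟨Or.inl rfl, hnab, hnac⟩
    have hwb0 : w ≠ b := by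
      rintro rfl
      exact hdb hdw
    have hwc0 : w ≠ c := by
      rintro rfl
      exact hdc hdw
    have hwa : G.Adj w a := by
      rcases hda with rfl | hda
      · exact hdw.symm
      by_contra hwa
      have haw : ¬ G.Adj a w := fun h => hwa h.symm
      have hdb0 : b ≠ d := by
        rintro rfl
        exact hba hda
      have hdc0 : c ≠ d := by
        rintro rfl
        exact hnac hda.symm
      have hwb : G.Adj w b := by
        by_contra hwb
        exact hG a d w b hda.symm hdw hwa0.symm haw hab.symm hdb0 hwb0.symm hnab hdb hwb
      have hwc : G.Adj w c := by
        by_contra hwc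
        exact hG a d w c hda.symm hdw hwa0.symm haw hac.symm hdc0 hwc0.symm hnac hdc hwc
      exact hG b w c a hwb.symm hwc hbc hnbc hab hwa0.symm hac hba hwa fun h => hnac h.symm
    have hwc : G.Adj w c := by
      by_contra hwc
      have hwb : G.Adj w b := by
        by_contra hwb
        exact hw ⟨Or.inr hwa, hwb, hwc⟩
      exact hG a w b c hwa.symm hwb hab hnab hac.symm hwc0.symm hbc.symm hnac hwc hnbc
    rcases heb with rfl | heb
    · by_contra hwb
      exact hG a w c e hwa.symm hwc hac hnac hab.symm hwb0.symm hbc hnab hwb fun h => hnbc h.symm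
    · by_contra hwe
      refine hG a w c e hwa.symm hwc hac hnac ?_ ?_ ?_ (fun h => hea h.symm) hwe
        fun h => hec h.symm
      · rintro rfl
        exact hnab heb
      · rintro rfl
        exact hea hwa
      · rintro rfl
        exact hnbc heb.symm

lemma NoPathPlusPoint.induce {V : Type*} {G : SimpleGraph V} (hG : NoPathPlusPoint G)
    (s : Set V) : NoPathPlusPoint (G.induce s) := by
  rintro ⟨a, _⟩ ⟨b, _⟩ ⟨c, _⟩ ⟨d, _⟩
  simpa using hG a b c d

lemma cliqueNum_induce_le {V : Type*} [Finite V] (G : SimpleGraph V) (s : Set V) :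
    (G.induce s).cliqueNum ≤ G.cliqueNum := by
  classical
  have := Fintype.ofFinite V
  obtain ⟨t, ht⟩ := (G.induce s).exists_isNClique_cliqueNum
  have h := (ht.map (f := Function.Embedding.subtype _)).mono (map_comap_le _ G)
  rw [← h.card_eq]
  exact h.isClique.card_le_cliqueNum

theorem NoPathPlusPoint.colorable {V : Type*} [Fintype V] {G : SimpleGraph V}
    (hG : NoPathPlusPoint G) {k : ℕ} (hk : 9 ≤ k) (hdeg : ∀ v, {w | G.Adj v w}.ncard ≤ k)
    (hω : G.cliqueNum < k) : G.Colorable (k - 1) := by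
  classical
  induction hn : Fintype.card V using Nat.strong_induction_on generalizing V with
  | _ n ih =>
    subst hn
    by_cases htri : ∀ a b c, Gᶜ.Adj a b → Gᶜ.Adj b c → ¬ Gᶜ.Adj a c
    · exact colorable_of_compl_triangleFree G hk htri hdeg hω
    push Not at htri
    obtain ⟨a, b, c, ⟨hab, hnab⟩, ⟨hbc, hnbc⟩, hac, hnac⟩ := htri
    have key : ∀ A : Finset V, A.Nonempty → (G.induce {v | v ∉ A}).Colorable (k - 1) := by
      rintro A ⟨x, hx⟩
      refine ih _ ?_ (hG.induce _) (fun v => ?_) ((cliqueNum_induce_le G _).trans_lt hω) rfl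
      · exact Fintype.card_subtype_lt (x := x) (by simpa using hx)
      · refine le_trans ?_ (hdeg v)
        rw [← Set.ncard_image_of_injective _ Subtype.val_injective]
        refine Set.ncard_le_ncard ?_ (Set.toFinite _)
        rintro _ ⟨w, hw, rfl⟩
        exact hw
    have hba : ¬ G.Adj b a := fun h => hnab h.symm
    rcases le_total (attached G a b c).card (attached G b a c).card with h | h
    · exact hG.colorable_of_card_attached_le hab hac hbc hnab hnac hnbc h
        (key _ ⟨a, mem_attached.mpr ⟨Or.inl rfl, hnab, hnac⟩⟩)
    · exact hG.colorable_of_card_attached_le hab.symm hbc hac hba hnbc hnac h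
        (key _ ⟨b, mem_attached.mpr ⟨Or.inl rfl, hba, hnbc⟩⟩)

/-- Borodin–Kostochka for `(P₃ ∪ K₁)`-free graphs: if `Δ(G) ≥ 9` and `G` has no induced
subgraph isomorphic to `P₃ ∪ K₁`, then `χ(G) ≤ max {ω(G), Δ(G) - 1}`. -/
theorem borodin_kostochka_P3_union_K1_free {V : Type*} [Fintype V] (G : SimpleGraph V)
    (hΔ : 9 ≤ maxDeg G) (hfree : IndFree graphH G) :
    G.chromaticNumber ≤ ((max G.cliqueNum (maxDeg G - 1) : ℕ) : ℕ∞) := by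
  classical
  rw [chromaticNumber_le_iff_colorable]
  have hdeg : ∀ v, {w | G.Adj v w}.ncard ≤ maxDeg G := by
    intro v
    rw [ncard_adj_eq_degree]
    unfold maxDeg
    convert G.degree_le_maxDegree v
  exact (noPathPlusPoint_of_indFree hfree).colorable (k := max G.cliqueNum (maxDeg G - 1) + 1)
    (by omega) (fun v => (hdeg v).trans (by omega)) (by omega)
end

section
/- If G is a finite simple graph with maximum degree Δ(G) ≥ 9 that contains no induced subgraph isomorphic to the disjoint union K₂ ∪ 2K₁ (an edge together with two isolated vertices), then the chromatic number of G satisfies χ(G) ≤ max{ω(G), Δ(G) − 1}, where ω(G) is the clique number of G. -/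
open SimpleGraph

/-- A packing of pairwise disjoint cliques of `H`, each of size at most `r`: the first index is the
set of covered vertices and the second is the sum of `|C| - 1` over the cliques `C` of the packing,
that is, the number of colours it saves in the complement of `H`. -/
inductive CliquePacking {V : Type*} [DecidableEq V] (H : SimpleGraph V) (r : ℕ) :
    Finset V → ℕ → Prop
  | empty : CliquePacking H r ∅ 0
  | union {C S : Finset V} {k : ℕ} (hC : H.IsClique C) (hne : C.Nonempty) (hr : C.card ≤ r)
      (hCS : Disjoint C S) (hS : CliquePacking H r S k) :
      CliquePacking H r (C ∪ S) (k + (C.card - 1))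

namespace CliquePacking

variable {V : Type*} [DecidableEq V] {H : SimpleGraph V} {r : ℕ} {S : Finset V} {k : ℕ}

theorem insert_pair (h : CliquePacking H r S k) (hr : 2 ≤ r) {a b : V} (hab : H.Adj a b)
    (ha : a ∉ S) (hb : b ∉ S) : CliquePacking H r ({a, b} ∪ S) (k + 1) := by
  have hc : ({a, b} : Finset V).card = 2 := Finset.card_pair hab.ne
  have := union (C := {a, b}) (r := r) ?_ ⟨a, by simp⟩ (by omega) ?_ h
  · simpa [hc] using this
  · simpa using fun _ => hab
  · simp [ha, hb]

theorem insert_triangle (h : CliquePacking H r S k) (hr : 3 ≤ r) {a b c : V} (hab : H.Adj a b)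
    (hac : H.Adj a c) (hbc : H.Adj b c) (ha : a ∉ S) (hb : b ∉ S) (hc : c ∉ S) :
    CliquePacking H r ({a, b, c} ∪ S) (k + 2) := by
  have h3 : ({a, b, c} : Finset V).card = 3 :=
    Finset.card_eq_three.2 ⟨a, b, c, hab.ne, hac.ne, hbc.ne, rfl⟩
  have := union (C := {a, b, c}) (r := r) ?_ ⟨a, by simp⟩ (by omega) ?_ h
  · simpa [h3] using this
  · simp [SimpleGraph.isClique_iff, Set.pairwise_insert, hab, hac, hbc, hab.symm, hac.symm,
      hbc.symm]
  · simp [ha, hb, hc]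

theorem union_singletons (h : CliquePacking H r S k) (hr : 1 ≤ r) (T : Finset V)
    (hT : Disjoint T S) : CliquePacking H r (T ∪ S) k := by
  induction T using Finset.induction with
  | empty => simpa using h
  | insert a T ha ih =>
    rw [Finset.disjoint_insert_left] at hT
    have := union (C := {a}) (r := r) (by simp) (by simp) (by simpa using hr) ?_ (ih hT.2)
    · simpa [Finset.insert_union, ← Finset.insert_eq] using this
    · simp [ha, hT.1]

theorem mono {r' : ℕ} (h : CliquePacking H r S k) (hr : r ≤ r') : CliquePacking H r' S k := by
  induction h with
  | empty => exact empty
  | union hC hne hcard hCS _ ih => exact union hC hne (hcard.trans hr) hCS ih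

theorem exists_coloring_on (h : CliquePacking H r S k) :
    ∃ c : V → ℕ, (∀ v ∈ S, c v + k < S.card) ∧
      (∀ v ∈ S, ∀ w ∈ S, v ≠ w → c v = c w → H.Adj v w) ∧ k ≤ S.card := by
  induction h with
  | empty => exact ⟨fun _ => 0, by simp⟩
  | @union C S k hC hne hcard hCS _ ih =>
    obtain ⟨c, hlt, hadj, hk⟩ := ih
    have hpos := hne.card_pos
    refine ⟨fun v => if v ∈ C then S.card - k else c v, ?_, ?_, ?_⟩
    · intro v hv
      rw [Finset.card_union_of_disjoint hCS]
      by_cases hvC : v ∈ C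
      · simp only [hvC, if_true]; omega
      · have := hlt v (by simpa [hvC] using hv)
        simp only [hvC, if_false]; omega
    · intro v hv w hw hvw
      by_cases hvC : v ∈ C <;> by_cases hwC : w ∈ C <;> simp only [hvC, hwC, if_true, if_false]
      · exact fun _ => hC hvC hwC hvw
      · have := hlt w (by simpa [hwC] using hw)
        omega
      · have := hlt v (by simpa [hvC] using hv)
        omega
      · exact hadj v (by simpa [hvC] using hv) w (by simpa [hwC] using hw) hvw
    · rw [Finset.card_union_of_disjoint hCS]; omega

theorem colorable_compl [Fintype V] (h : CliquePacking H r S k) :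
    Hᶜ.Colorable (Fintype.card V - k) := by
  have h' := (h.mono (Nat.le_succ r)).union_singletons (by omega) Sᶜ disjoint_compl_left
  rw [Finset.union_comm, Finset.union_compl] at h'
  obtain ⟨c, hlt, hadj, hk⟩ := h'.exists_coloring_on
  refine (SimpleGraph.colorable_iff_exists_bdd_nat_coloring _).2
    ⟨SimpleGraph.Coloring.mk c ?_, ?_⟩
  · intro v w hvw hc
    rw [SimpleGraph.compl_adj] at hvw
    exact hvw.2 (hadj v (by simp) w (by simp) hvw.1 hc)
  · intro v
    have := hlt v (by simp)
    change c v < _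
    simp at this
    omega

end CliquePacking

/-- The pairs `{x i, y i}` form a matching of `H`. -/
structure IsMatchingPairs {V ι : Type*} (H : SimpleGraph V) (x y : ι → V) : Prop where
  adj : ∀ i, H.Adj (x i) (y i)
  disj : ∀ i j, i ≠ j → x i ≠ x j ∧ x i ≠ y j ∧ y i ≠ x j ∧ y i ≠ y j

namespace IsMatchingPairs

variable {V ι : Type*} {H : SimpleGraph V} {x y : ι → V}

theorem ne_xy (h : IsMatchingPairs H x y) (i j : ι) : x i ≠ y j := by
  by_cases hij : i = j
  · exact hij ▸ (h.adj i).ne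
  · exact (h.disj i j hij).2.1

theorem injective_x (h : IsMatchingPairs H x y) : Function.Injective x :=
  fun i j hij => by_contra fun hne => (h.disj i j hne).1 hij

theorem injective_y (h : IsMatchingPairs H x y) : Function.Injective y :=
  fun i j hij => by_contra fun hne => (h.disj i j hne).2.2.2 hij

theorem cliquePacking [DecidableEq V] [DecidableEq ι] (h : IsMatchingPairs H x y) {r : ℕ} (hr : 2 ≤ r)
    (I : Finset ι) : CliquePacking H r (I.biUnion fun i => {x i, y i}) I.card := by
  induction I using Finset.induction with
  | empty => exact .empty
  | insert i I hi ih =>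
    rw [Finset.card_insert_of_notMem hi, Finset.biUnion_insert]
    refine ih.insert_pair hr (h.adj i) ?_ ?_ <;>
    · simp only [Finset.mem_biUnion, Finset.mem_insert, Finset.mem_singleton, not_exists, not_and,
        not_or]
      intro j hj
      have := h.disj i j (by rintro rfl; exact hi hj)
      tauto

theorem swap (h : IsMatchingPairs H x y) (p : ι → Prop) [DecidablePred p] :
    IsMatchingPairs H (fun i => if p i then y i else x i) (fun i => if p i then x i else y i) := by
  refine ⟨fun i => ?_, fun i j hij => ?_⟩
  · have := h.adj i
    by_cases hp : p i <;> simp [hp, this, this.symm]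
  · have := h.disj i j hij
    by_cases hp : p i <;> by_cases hq : p j <;> simp [hp, hq, this]

end IsMatchingPairs

theorem CliquePacking.exists_isMatchingPairs {V : Type*} [DecidableEq V] {H : SimpleGraph V}
    {S : Finset V} {k : ℕ} (h : CliquePacking H 2 S k) :
    ∃ x y : Fin k → V, IsMatchingPairs H x y ∧ ∀ i, x i ∈ S ∧ y i ∈ S := by
  induction h with
  | empty => exact ⟨Fin.elim0, Fin.elim0, ⟨fun i => i.elim0, fun i => i.elim0⟩, fun i => i.elim0⟩
  | @union C S k hC hne hcard hCS _ ih =>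
    obtain ⟨x, y, hxy, hS⟩ := ih
    have hpos := hne.card_pos
    obtain h1 | h2 : C.card = 1 ∨ C.card = 2 := by omega
    · rw [h1]
      exact ⟨x, y, hxy, fun i => ⟨Finset.mem_union_right _ (hS i).1,
        Finset.mem_union_right _ (hS i).2⟩⟩
    · rw [h2]
      obtain ⟨a, b, hab, rfl⟩ := Finset.card_eq_two.1 h2
      have hadj : H.Adj a b := hC (by simp) (by simp) hab
      simp only [Finset.disjoint_insert_left, Finset.disjoint_singleton_left] at hCS
      have key : ∀ i, a ≠ x i ∧ a ≠ y i ∧ b ≠ x i ∧ b ≠ y i := fun i => by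
        
        have := hS i
        exact ⟨by grind, by grind, by grind, by grind⟩
      refine ⟨Fin.cons a x, Fin.cons b y, ⟨fun i => ?_, fun i j hij => ?_⟩, fun i => ?_⟩
      · cases i using Fin.cases <;> simp [hadj, hxy.adj]
      · cases i using Fin.cases with
        | zero =>
          cases j using Fin.cases with
          | zero => exact absurd rfl hij
          | succ j => simpa using key j
        | succ i =>
          cases j using Fin.cases with
          | zero => have := key i; simp; tauto
          | succ j => simpa using hxy.disj i j (by simpa using hij)
      · cases i using Fin.cases <;> simp [hS]

/-- A matching with `m` pairs whose independent set `U` of unmatched vertices is adjacent to the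
`x`-side only, and which admits neither augmentation nor a packing saving `d + 2`. -/
structure IsTightMatching {V : Type*} [Fintype V] [DecidableEq V] (H : SimpleGraph V) (d m : ℕ)
    (x y : Fin m → V) (U : Finset V) : Prop where
  pairs : IsMatchingPairs H x y
  mem_iff : ∀ v, v ∈ U ↔ ∀ i, v ≠ x i ∧ v ≠ y i
  card : 2 * m + U.card = Fintype.card V
  indep : ∀ u ∈ U, ∀ v ∈ U, ¬ H.Adj u v
  not_adj : ∀ u ∈ U, ∀ i, ¬ H.Adj u (y i)
  maximum : ∀ S, ¬ CliquePacking H 2 S (m + 1)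
  no_packing : ∀ S, ¬ CliquePacking H (Fintype.card V) S (d + 2)

namespace IsMatchingPairs

variable {V : Type*} [DecidableEq V] {H : SimpleGraph V} {m : ℕ} {x y : Fin m → V}

theorem notMem_biUnion {I : Finset (Fin m)} {v : V} (h : ∀ i ∈ I, v ≠ x i ∧ v ≠ y i) :
    v ∉ I.biUnion fun i => ({x i, y i} : Finset V) := by
  simp only [Finset.mem_biUnion, Finset.mem_insert, Finset.mem_singleton, not_exists, not_and,
    not_or]
  exact h

theorem card_add_card [Fintype V] (h : IsMatchingPairs H x y) {U : Finset V}
    (hU : ∀ v, v ∈ U ↔ ∀ i, v ≠ x i ∧ v ≠ y i) : 2 * m + U.card = Fintype.card V := by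
  have h1 : Uᶜ = Finset.univ.image x ∪ Finset.univ.image y := by
    ext v
    simp only [Finset.mem_compl, hU, Finset.mem_union, Finset.mem_image, Finset.mem_univ, true_and]
    constructor
    · intro hv
      push Not at hv
      obtain ⟨i, hi⟩ := hv
      by_cases hx : v = x i
      · exact .inl ⟨i, hx.symm⟩
      · exact .inr ⟨i, (hi hx).symm⟩
    · rintro (⟨i, rfl⟩ | ⟨i, rfl⟩) hv
      · exact (hv i).1 rfl
      · exact (hv i).2 rfl
  have h2 : Uᶜ.card = m + m := by
    rw [h1, Finset.card_union_of_disjoint, Finset.card_image_of_injective _ h.injective_x,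
      Finset.card_image_of_injective _ h.injective_y, Finset.card_univ, Fintype.card_fin]
    rw [Finset.disjoint_left]
    simp only [Finset.mem_image, Finset.mem_univ, true_and, not_exists]
    rintro _ ⟨i, rfl⟩ j hj
    exact h.ne_xy i j hj.symm
  have h3 := Finset.card_add_card_compl U
  omega

variable {r : ℕ}

theorem augment_unmatched (h : IsMatchingPairs H x y) (hr : 2 ≤ r) {u v : V}
    (hu : ∀ i, u ≠ x i ∧ u ≠ y i) (hv : ∀ i, v ≠ x i ∧ v ≠ y i) (huv : H.Adj u v) :
    ∃ S, CliquePacking H r S (m + 1) := by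
  have := h.cliquePacking hr Finset.univ
  rw [Finset.card_univ, Fintype.card_fin] at this
  exact ⟨_, this.insert_pair hr huv (notMem_biUnion fun i _ => hu i)
    (notMem_biUnion fun i _ => hv i)⟩

theorem augment_one (h : IsMatchingPairs H x y) (hr : 2 ≤ r) {u v : V}
    (hu : ∀ i, u ≠ x i ∧ u ≠ y i) (hv : ∀ i, v ≠ x i ∧ v ≠ y i) (huv : u ≠ v) {i : Fin m}
    (hxu : H.Adj (x i) u) (hyv : H.Adj (y i) v) : ∃ S, CliquePacking H r S (m + 1) := by
  have hb := h.cliquePacking hr (Finset.univ.erase i)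
  rw [Finset.card_erase_of_mem (Finset.mem_univ _), Finset.card_univ, Fintype.card_fin] at hb
  have hxy := (h.adj i).ne
  have hdis := fun j (hj : j ∈ Finset.univ.erase i) => h.disj i j (Finset.ne_of_mem_erase hj).symm
  have h1 := hb.insert_pair hr hxu (notMem_biUnion fun j hj => ⟨(hdis j hj).1, (hdis j hj).2.1⟩)
    (notMem_biUnion fun j _ => hu j)
  have h2 := h1.insert_pair hr hyv
    (by
      have := notMem_biUnion (y := y) fun j hj => ⟨(hdis j hj).2.2.1, (hdis j hj).2.2.2⟩
      have := (hu i).2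
      grind)
    (by
      have := notMem_biUnion (I := Finset.univ.erase i) fun j _ => hv j
      have := (hv i).1
      grind)
  have : m - 1 + 1 + 1 = m + 1 := by have := i.pos; omega
  exact ⟨_, this ▸ h2⟩

theorem augment_triangle (h : IsMatchingPairs H x y) (hr : 3 ≤ r) {u : V}
    (hu : ∀ i, u ≠ x i ∧ u ≠ y i) {i : Fin m}
    (hxu : H.Adj (x i) u) (hyu : H.Adj (y i) u) : ∃ S, CliquePacking H r S (m + 1) := by
  have hb := h.cliquePacking (by omega : 2 ≤ r) (Finset.univ.erase i)
  rw [Finset.card_erase_of_mem (Finset.mem_univ _), Finset.card_univ, Fintype.card_fin] at hb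
  have hdis := fun j (hj : j ∈ Finset.univ.erase i) => h.disj i j (Finset.ne_of_mem_erase hj).symm
  have h1 := hb.insert_triangle hr (h.adj i) hxu hyu
    (notMem_biUnion fun j hj => ⟨(hdis j hj).1, (hdis j hj).2.1⟩)
    (notMem_biUnion fun j hj => ⟨(hdis j hj).2.2.1, (hdis j hj).2.2.2⟩)
    (notMem_biUnion fun j _ => hu j)
  have : m - 1 + 2 = m + 1 := by have := i.pos; omega
  exact ⟨_, this ▸ h1⟩

theorem augment_two (h : IsMatchingPairs H x y) (hr : 2 ≤ r) {u v : V}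
    (hu : ∀ i, u ≠ x i ∧ u ≠ y i) (hv : ∀ i, v ≠ x i ∧ v ≠ y i) (huv : u ≠ v) {i j : Fin m}
    (hij : i ≠ j) (hxu : H.Adj (x i) u) (hxv : H.Adj (x j) v) (hy : H.Adj (y i) (y j)) :
    ∃ S, CliquePacking H r S (m + 1) := by
  set I : Finset (Fin m) := {i, j}ᶜ with hI
  have hc := Finset.card_add_card_compl ({i, j} : Finset (Fin m))
  rw [Finset.card_pair hij, Fintype.card_fin, ← hI] at hc
  have hb := h.cliquePacking hr I
  have hi : ∀ k ∈ I, i ≠ k ∧ j ≠ k := by intro k hk; simp [hI] at hk; grind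
  have hdi := fun k hk => h.disj i k (hi k hk).1
  have hdj := fun k hk => h.disj j k (hi k hk).2
  have nxi := notMem_biUnion fun k hk => ⟨(hdi k hk).1, (hdi k hk).2.1⟩
  have nyi := notMem_biUnion fun k hk => ⟨(hdi k hk).2.2.1, (hdi k hk).2.2.2⟩
  have nxj := notMem_biUnion fun k hk => ⟨(hdj k hk).1, (hdj k hk).2.1⟩
  have nyj := notMem_biUnion fun k hk => ⟨(hdj k hk).2.2.1, (hdj k hk).2.2.2⟩
  have nu := notMem_biUnion (I := I) fun k _ => hu k
  have nv := notMem_biUnion (I := I) fun k _ => hv k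
  have hdij := h.disj i j hij
  have := hu i; have := hu j; have := hv i; have := hv j
  have := h.ne_xy i i; have := h.ne_xy j j
  have h1 := hb.insert_pair hr hxu nxi nu
  have h2 := h1.insert_pair hr hxv (by grind) (by grind)
  have h3 := h2.insert_pair hr hy (by grind) (by grind)
  have : I.card + 1 + 1 + 1 = m + 1 := by omega
  exact ⟨_, this ▸ h3⟩

theorem augment_three (h : IsMatchingPairs H x y) (hr : 2 ≤ r) {u v : V}
    (hu : ∀ i, u ≠ x i ∧ u ≠ y i) (hv : ∀ i, v ≠ x i ∧ v ≠ y i) (huv : u ≠ v) {i j k : Fin m}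
    (hij : i ≠ j) (hik : i ≠ k) (hjk : j ≠ k) (hxu : H.Adj (x i) u) (hxv : H.Adj (x j) v)
    (hyi : H.Adj (y i) (x k)) (hyj : H.Adj (y j) (y k)) :
    ∃ S, CliquePacking H r S (m + 1) := by
  set I : Finset (Fin m) := {i, j, k}ᶜ with hI
  have hc := Finset.card_add_card_compl ({i, j, k} : Finset (Fin m))
  rw [Finset.card_eq_three.2 ⟨i, j, k, hij, hik, hjk, rfl⟩, Fintype.card_fin, ← hI] at hc
  have hb := h.cliquePacking hr I
  have hi : ∀ l ∈ I, i ≠ l ∧ j ≠ l ∧ k ≠ l := by intro k hk; simp [hI] at hk; grind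
  have hdi := fun l hl => h.disj i l (hi l hl).1
  have hdj := fun l hl => h.disj j l (hi l hl).2.1
  have hdk := fun l hl => h.disj k l (hi l hl).2.2
  have nxi := notMem_biUnion fun l hl => ⟨(hdi l hl).1, (hdi l hl).2.1⟩
  have nyi := notMem_biUnion fun l hl => ⟨(hdi l hl).2.2.1, (hdi l hl).2.2.2⟩
  have nxj := notMem_biUnion fun l hl => ⟨(hdj l hl).1, (hdj l hl).2.1⟩
  have nyj := notMem_biUnion fun l hl => ⟨(hdj l hl).2.2.1, (hdj l hl).2.2.2⟩
  have nxk := notMem_biUnion fun l hl => ⟨(hdk l hl).1, (hdk l hl).2.1⟩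
  have nyk := notMem_biUnion fun l hl => ⟨(hdk l hl).2.2.1, (hdk l hl).2.2.2⟩
  have nu := notMem_biUnion (I := I) fun k _ => hu k
  have nv := notMem_biUnion (I := I) fun k _ => hv k
  have hdij := h.disj i j hij
  have hdik := h.disj i k hik
  have hdjk := h.disj j k hjk
  have := hu i; have := hu j; have := hu k; have := hv i; have := hv j; have := hv k
  have := h.ne_xy i i; have := h.ne_xy j j; have := h.ne_xy k k
  have h1 := hb.insert_pair hr hxu nxi nu
  have h2 := h1.insert_pair hr hxv (by grind) (by grind)
  have h3 := h2.insert_pair hr hyi (by grind) (by grind)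
  have h4 := h3.insert_pair hr hyj (by grind) (by grind)
  have : I.card + 1 + 1 + 1 + 1 = m + 1 := by omega
  exact ⟨_, this ▸ h4⟩

theorem augment_triangle_two (h : IsMatchingPairs H x y) (hr : 3 ≤ r) {u : V}
    (hu : ∀ i, u ≠ x i ∧ u ≠ y i) {i j : Fin m} (hij : i ≠ j) (hxu : H.Adj (x i) u)
    (hyx : H.Adj (y i) (x j)) (hyy : H.Adj (y i) (y j)) :
    ∃ S, CliquePacking H r S (m + 1) := by
  set I : Finset (Fin m) := {i, j}ᶜ with hI
  have hc := Finset.card_add_card_compl ({i, j} : Finset (Fin m))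
  rw [Finset.card_pair hij, Fintype.card_fin, ← hI] at hc
  have hb := h.cliquePacking (by omega : 2 ≤ r) I
  have hi : ∀ k ∈ I, i ≠ k ∧ j ≠ k := by intro k hk; simp [hI] at hk; grind
  have hdi := fun k hk => h.disj i k (hi k hk).1
  have hdj := fun k hk => h.disj j k (hi k hk).2
  have nxi := notMem_biUnion fun k hk => ⟨(hdi k hk).1, (hdi k hk).2.1⟩
  have nyi := notMem_biUnion fun k hk => ⟨(hdi k hk).2.2.1, (hdi k hk).2.2.2⟩
  have nxj := notMem_biUnion fun k hk => ⟨(hdj k hk).1, (hdj k hk).2.1⟩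
  have nyj := notMem_biUnion fun k hk => ⟨(hdj k hk).2.2.1, (hdj k hk).2.2.2⟩
  have nu := notMem_biUnion (I := I) fun k _ => hu k
  have hdij := h.disj i j hij
  have := hu i; have := hu j
  have := h.ne_xy i i; have := h.ne_xy j j
  have h1 := hb.insert_pair (by omega) hxu nxi nu
  have h2 := h1.insert_triangle hr hyx hyy (h.adj j) (by grind) (by grind) (by grind)
  have : I.card + 1 + 2 = m + 1 := by omega
  exact ⟨_, this ▸ h2⟩

theorem augment_triangle_three (h : IsMatchingPairs H x y) (hr : 3 ≤ r) {u : V}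
    (hu : ∀ i, u ≠ x i ∧ u ≠ y i) {i j k : Fin m} (hij : i ≠ j) (hik : i ≠ k) (hjk : j ≠ k)
    (hxu : H.Adj (x i) u) (hyy : H.Adj (y i) (y j)) (hix : H.Adj (y i) (x k))
    (hjx : H.Adj (y j) (x k)) (hk : H.Adj (x j) (y k)) :
    ∃ S, CliquePacking H r S (m + 1) := by
  set I : Finset (Fin m) := {i, j, k}ᶜ with hI
  have hc := Finset.card_add_card_compl ({i, j, k} : Finset (Fin m))
  rw [Finset.card_eq_three.2 ⟨i, j, k, hij, hik, hjk, rfl⟩, Fintype.card_fin, ← hI] at hc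
  have hb := h.cliquePacking (by omega : 2 ≤ r) I
  have hi : ∀ l ∈ I, i ≠ l ∧ j ≠ l ∧ k ≠ l := by intro k hk; simp [hI] at hk; grind
  have hdi := fun l hl => h.disj i l (hi l hl).1
  have hdj := fun l hl => h.disj j l (hi l hl).2.1
  have hdk := fun l hl => h.disj k l (hi l hl).2.2
  have nxi := notMem_biUnion fun l hl => ⟨(hdi l hl).1, (hdi l hl).2.1⟩
  have nyi := notMem_biUnion fun l hl => ⟨(hdi l hl).2.2.1, (hdi l hl).2.2.2⟩
  have nxj := notMem_biUnion fun l hl => ⟨(hdj l hl).1, (hdj l hl).2.1⟩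
  have nyj := notMem_biUnion fun l hl => ⟨(hdj l hl).2.2.1, (hdj l hl).2.2.2⟩
  have nxk := notMem_biUnion fun l hl => ⟨(hdk l hl).1, (hdk l hl).2.1⟩
  have nyk := notMem_biUnion fun l hl => ⟨(hdk l hl).2.2.1, (hdk l hl).2.2.2⟩
  have nu := notMem_biUnion (I := I) fun k _ => hu k
  have hdij := h.disj i j hij
  have hdik := h.disj i k hik
  have hdjk := h.disj j k hjk
  have := hu i; have := hu j; have := hu k
  have := h.ne_xy i i; have := h.ne_xy j j; have := h.ne_xy k k
  have h1 := hb.insert_pair (by omega) hxu nxi nu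
  have h2 := h1.insert_pair (by omega) hk (by grind) (by grind)
  have h3 := h2.insert_triangle hr hyy hix hjx (by grind) (by grind) (by grind)
  have : I.card + 1 + 1 + 2 = m + 1 := by omega
  exact ⟨_, this ▸ h3⟩

end IsMatchingPairs

/-- Number of neighbours of `v` in `U`. -/
def degreeIn {V : Type*} (H : SimpleGraph V) [DecidableRel H.Adj] (U : Finset V) (v : V) : ℕ :=
  (U.filter (H.Adj v)).card

section degreeIn

variable {V : Type*} {H : SimpleGraph V} [DecidableRel H.Adj] {U : Finset V}

theorem degreeIn_le (v : V) : degreeIn H U v ≤ U.card := Finset.card_filter_le _ _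

theorem adj_of_card_le_degreeIn {v : V} (h : U.card ≤ degreeIn H U v) : ∀ u ∈ U, H.Adj v u := by
  have := Finset.eq_of_subset_of_card_le (Finset.filter_subset (H.Adj v) U) h
  exact fun u hu => (Finset.mem_filter.1 (this ▸ hu)).2

theorem exists_adj_of_degreeIn_pos {v : V} (h : 0 < degreeIn H U v) : ∃ u ∈ U, H.Adj v u := by
  obtain ⟨u, hu⟩ := Finset.card_pos.1 h
  exact ⟨u, Finset.mem_filter.1 hu⟩

theorem degreeIn_le_one {v u : V} (h : ∀ w ∈ U, H.Adj v w → w = u) : degreeIn H U v ≤ 1 :=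
  Finset.card_le_one.2 fun a ha b hb => by
    rw [Finset.mem_filter] at ha hb
    rw [h a ha.1 ha.2, h b hb.1 hb.2]

theorem exists_adj_ne_of_one_lt_degreeIn {v u : V} (h : 1 < degreeIn H U v) :
    ∃ w ∈ U, H.Adj v w ∧ w ≠ u := by
  by_contra! hc
  have := degreeIn_le_one hc
  omega

theorem degreeIn_eq_zero {v : V} (h : ∀ u ∈ U, ¬ H.Adj v u) : degreeIn H U v = 0 := by
  rw [degreeIn, Finset.card_eq_zero, Finset.filter_eq_empty_iff]
  exact fun u hu => h u hu

/-- Double counting of the edges between a matching and its unmatched vertices. -/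
theorem IsMatchingPairs.mul_le_sum_degreeIn [Fintype V] [DecidableEq V] {m d : ℕ} {x y : Fin m → V}
    (hU : ∀ v, v ∈ U ↔ ∀ i, v ≠ x i ∧ v ≠ y i) (hind : ∀ u ∈ U, ∀ v ∈ U, ¬ H.Adj u v)
    (hdeg : ∀ v, d ≤ H.degree v) :
    d * U.card ≤ ∑ i, (degreeIn H U (x i) + degreeIn H U (y i)) := by
  have key : ∀ u ∈ U, d ≤ ∑ i, ((if H.Adj (x i) u then 1 else 0) +
      if H.Adj (y i) u then 1 else 0) := by
    intro u hu
    refine (hdeg u).trans ?_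
    rw [← SimpleGraph.card_neighborFinset_eq_degree, Finset.sum_add_distrib, ← Finset.card_filter,
      ← Finset.card_filter]
    refine le_trans (Finset.card_le_card (t := (Finset.univ.filter fun i => H.Adj (x i) u).image x ∪
      (Finset.univ.filter fun i => H.Adj (y i) u).image y) ?_) ((Finset.card_union_le _ _).trans
        (Nat.add_le_add Finset.card_image_le Finset.card_image_le))
    intro v hv
    rw [SimpleGraph.mem_neighborFinset] at hv
    have hvU : v ∉ U := fun h => hind u hu v h hv
    rw [hU] at hvU
    push Not at hvU
    obtain ⟨i, hi⟩ := hvU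
    simp only [Finset.mem_union, Finset.mem_image, Finset.mem_filter, Finset.mem_univ, true_and]
    by_cases hx : v = x i
    · exact .inl ⟨i, hx ▸ hv.symm, hx.symm⟩
    · exact .inr ⟨i, hi hx ▸ hv.symm, (hi hx).symm⟩
  calc d * U.card = ∑ _u ∈ U, d := by simp [mul_comm]
    _ ≤ _ := Finset.sum_le_sum key
    _ = _ := by
      rw [Finset.sum_comm]
      refine Finset.sum_congr rfl fun i _ => ?_
      rw [Finset.sum_add_distrib, ← Finset.card_filter, ← Finset.card_filter]
      rfl

end degreeIn

namespace IsTightMatching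

variable {V : Type*} [Fintype V] [DecidableEq V] {H : SimpleGraph V} {d m : ℕ}
  {x y : Fin m → V} {U : Finset V}

theorem not_adj' (h : IsTightMatching H d m x y U) {u : V} (hu : u ∈ U) (i : Fin m) :
    ¬ H.Adj (y i) u := fun h' => h.not_adj u hu i h'.symm

theorem exists_isIndepSet (h : IsTightMatching H d m x y U)
    (hy : ∀ i j, i ≠ j → ¬ H.Adj (y i) (y j)) :
    ∃ T : Finset V, H.IsIndepSet T ∧ Fintype.card V ≤ T.card + m := by
  refine ⟨U ∪ Finset.univ.image y, ?_, ?_⟩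
  · intro a ha b hb hab
    simp only [Finset.coe_union, Finset.coe_image, Finset.coe_univ, Set.image_univ, Set.mem_union,
      Finset.mem_coe, Set.mem_range] at ha hb
    obtain ha | ⟨i, rfl⟩ := ha <;> obtain hb | ⟨j, rfl⟩ := hb
    · exact h.indep a ha b hb
    · exact h.not_adj a ha j
    · exact h.not_adj' hb i
    · exact hy i j fun e => hab (e ▸ rfl)
  · rw [Finset.card_union_of_disjoint, Finset.card_image_of_injective _ h.pairs.injective_y]
    · have := h.card
      simp
      omega
    · rw [Finset.disjoint_left]
      simp only [Finset.mem_image, Finset.mem_univ, true_and, not_exists]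
      intro a ha j hj
      exact ((h.mem_iff a).1 ha j).2 hj.symm

theorem eq_of_adj (h : IsTightMatching H d m x y U) {i j : Fin m} (hij : i ≠ j)
    (hy : H.Adj (y i) (y j)) {u v : V} (hu : u ∈ U) (hv : v ∈ U) (hxu : H.Adj (x i) u)
    (hxv : H.Adj (x j) v) : u = v := by
  by_contra huv
  obtain ⟨S, hS⟩ := h.pairs.augment_two le_rfl ((h.mem_iff u).1 hu) ((h.mem_iff v).1 hv) huv hij
    hxu hxv hy
  exact h.maximum S hS

theorem swap_one (h : IsTightMatching H d m x y U) {k : Fin m} (hk : ∀ u ∈ U, ¬ H.Adj (x k) u) :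
    IsTightMatching H d m (fun i => if i = k then y i else x i)
      (fun i => if i = k then x i else y i) U where
  pairs := h.pairs.swap _
  mem_iff v := by
    rw [h.mem_iff]
    refine forall_congr' fun i => ?_
    by_cases hi : i = k <;> simp [hi, and_comm]
  card := h.card
  indep := h.indep
  not_adj u hu i := by
    by_cases hi : i = k
    · subst hi
      simpa using fun h' => hk u hu h'.symm
    · simpa [hi] using h.not_adj u hu i
  maximum := h.maximum
  no_packing := h.no_packing

variable [DecidableRel H.Adj]

theorem sum_deficit_le (h : IsTightMatching H d m x y U) (hdeg : ∀ v, d ≤ H.degree v)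
    (I : Finset (Fin m)) : ∑ i ∈ I, (U.card - degreeIn H U (x i)) + d * U.card ≤ m * U.card := by
  have h1 := IsMatchingPairs.mul_le_sum_degreeIn h.mem_iff h.indep hdeg
  have h2 : ∑ i, (U.card - degreeIn H U (x i)) + ∑ i, degreeIn H U (x i) = m * U.card := by
    rw [← Finset.sum_add_distrib]
    simp [Nat.sub_add_cancel (degreeIn_le _)]
  have h3 : ∀ i, degreeIn H U (x i) + degreeIn H U (y i) = degreeIn H U (x i) := fun i => by
    rw [degreeIn_eq_zero fun u hu => h.not_adj' hu i, add_zero]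
  simp only [h3] at h1
  have h4 : ∑ i ∈ I, (U.card - degreeIn H U (x i)) ≤ ∑ i, (U.card - degreeIn H U (x i)) :=
    Finset.sum_le_sum_of_subset (Finset.subset_univ I)
  omega

theorem exists_isIndepSet_of_isolated (h : IsTightMatching H d m x y U) (hm : m ≤ d + 1)
    (hU2 : 2 ≤ U.card) (hV : 3 ≤ Fintype.card V) (hdeg : ∀ v, d ≤ H.degree v)
    {k : Fin m} (hk : degreeIn H U (x k) = 0) :
    ∃ T : Finset V, H.IsIndepSet T ∧ Fintype.card V ≤ T.card + m := by
  have hmd : m = d + 1 := by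
    by_contra hne
    have := h.sum_deficit_le hdeg {k}
    have := Nat.mul_le_mul_right U.card (by omega : m ≤ d)
    simp [hk] at *
    omega
  have hfull : ∀ i, i ≠ k → ∀ u ∈ U, H.Adj (x i) u := by
    intro i hi
    apply adj_of_card_le_degreeIn
    have := h.sum_deficit_le hdeg {k, i}
    rw [Finset.sum_pair hi.symm, hk, hmd, Nat.succ_mul] at this
    omega
  obtain ⟨u, hu, v, hv, huv⟩ := Finset.one_lt_card.1 hU2
  have hyy : ∀ i j, i ≠ k → j ≠ k → i ≠ j → ¬ H.Adj (y i) (y j) := fun i j hi hj hij hadj =>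
    huv (h.eq_of_adj hij hadj hu hv (hfull i hi u hu) (hfull j hj v hv))
  have hor : (∀ i, i ≠ k → ¬ H.Adj (y i) (y k)) ∨ ∀ i, i ≠ k → ¬ H.Adj (y i) (x k) := by
    by_contra! hc
    obtain ⟨⟨j, hj, hjy⟩, i, hi, hix⟩ := hc
    by_cases hij : i = j
    · subst hij
      obtain ⟨S, hS⟩ := h.pairs.augment_triangle_two hV ((h.mem_iff u).1 hu) hi
        (hfull i hi u hu) hix hjy
      exact h.no_packing S (by rwa [hmd] at hS)
    · obtain ⟨S, hS⟩ := h.pairs.augment_three le_rfl ((h.mem_iff u).1 hu) ((h.mem_iff v).1 hv) huv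
        hij hi hj (hfull i hi u hu) (hfull j hj v hv) hix hjy
      exact h.maximum S hS
  rcases hor with hor | hor
  · refine h.exists_isIndepSet fun i j hij hadj => ?_
    by_cases hi : i = k
    · exact hor j (hi ▸ hij.symm) (hi ▸ hadj.symm)
    by_cases hj : j = k
    · exact hor i hi (hj ▸ hadj)
    exact hyy i j hi hj hij hadj
  · have hk' : ∀ u ∈ U, ¬ H.Adj (x k) u := fun u hu hadj => by
      rw [degreeIn, Finset.card_eq_zero, Finset.filter_eq_empty_iff] at hk
      exact hk hu hadj
    refine (h.swap_one hk').exists_isIndepSet fun i j hij hadj => ?_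
    by_cases hi : i = k
    · have hj : j ≠ k := hi ▸ hij.symm
      simp only [hi, hj, if_true, if_false] at hadj
      exact hor j hj hadj.symm
    by_cases hj : j = k
    · simp only [hi, hj, if_true, if_false] at hadj
      exact hor i hi hadj
    simp only [hi, hj, if_false] at hadj
    exact hyy i j hi hj hij hadj

/-- If all neighbours of `y i` on the `y`-side have index in a small set, then `y i` has few
non-neighbours on the `x`-side. -/
theorem card_not_adj_le (h : IsTightMatching H d m x y U) (hdeg : ∀ v, d ≤ H.degree v) {i : Fin m}
    (J : Finset (Fin m)) (hJ : ∀ j, H.Adj (y i) (y j) → j ∈ J) :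
    (Finset.univ.filter fun j => ¬ H.Adj (y i) (x j)).card + d ≤ m + J.card := by
  have h1 : H.neighborFinset (y i) ⊆
      (Finset.univ.filter fun j => H.Adj (y i) (x j)).image x ∪ J.image y := by
    intro v hv
    rw [SimpleGraph.mem_neighborFinset] at hv
    have hvU : v ∉ U := fun hvU => h.not_adj' hvU i hv
    rw [h.mem_iff] at hvU
    push Not at hvU
    obtain ⟨j, hj⟩ := hvU
    simp only [Finset.mem_union, Finset.mem_image, Finset.mem_filter, Finset.mem_univ, true_and]
    by_cases hx : v = x j
    · exact .inl ⟨j, hx ▸ hv, hx.symm⟩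
    · exact .inr ⟨j, hJ j (hj hx ▸ hv), (hj hx).symm⟩
  have h2 := (Finset.card_le_card h1).trans ((Finset.card_union_le _ _).trans
        (Nat.add_le_add Finset.card_image_le Finset.card_image_le))
  rw [SimpleGraph.card_neighborFinset_eq_degree] at h2
  have h3 := Finset.card_filter_add_card_filter_not (s := Finset.univ)
    (fun j => H.Adj (y i) (x j))
  have h4 := hdeg (y i)
  rw [Finset.card_univ, Fintype.card_fin] at h3
  omega

theorem false_of_adj {x y : Fin (d + 1) → V} (h : IsTightMatching H d (d + 1) x y U)
    (hU2 : U.card = 2) (hd : 6 ≤ d) (hdeg : ∀ v, d ≤ H.degree v)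
    {i j : Fin (d + 1)} (hij : i ≠ j) (hyy : H.Adj (y i) (y j)) {u : V} (hu : u ∈ U)
    (hxi : H.Adj (x i) u) (hxj : H.Adj (x j) u) (hi1 : degreeIn H U (x i) ≤ 1)
    (hj1 : degreeIn H U (x j) ≤ 1) : False := by
  have hV : 3 ≤ Fintype.card V := by have := h.card; omega
  have hfull : ∀ t, t ≠ i → t ≠ j → 1 < degreeIn H U (x t) := by
    intro t hti htj
    have := h.sum_deficit_le hdeg {i, j, t}
    rw [Finset.sum_insert (by simp [hij, hti.symm]), Finset.sum_pair htj.symm, hU2] at this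
    omega
  have hnone : ∀ t, t ≠ i → t ≠ j → ∀ s, s ≠ t → 0 < degreeIn H U (x s) → ¬ H.Adj (y t) (y s) := by
    intro t hti htj s hst hs hadj
    obtain ⟨v, hv, hsv⟩ := exists_adj_of_degreeIn_pos hs
    obtain ⟨w, hw, htw, hwv⟩ := exists_adj_ne_of_one_lt_degreeIn (u := v) (hfull t hti htj)
    exact hwv (h.eq_of_adj hst.symm hadj hw hv htw hsv)
  have hpos : ∀ s, 0 < degreeIn H U (x s) := by
    intro s
    by_cases hsi : s = i
    · subst hsi; exact Finset.card_pos.2 ⟨u, Finset.mem_filter.2 ⟨hu, hxi⟩⟩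
    by_cases hsj : s = j
    · subst hsj; exact Finset.card_pos.2 ⟨u, Finset.mem_filter.2 ⟨hu, hxj⟩⟩
    have := hfull s hsi hsj
    omega
  have hbi := h.card_not_adj_le hdeg (i := i) {j} (by
    intro s hs
    by_contra hsj
    rw [Finset.mem_singleton] at hsj
    have hsi : s ≠ i := by rintro rfl; exact hs.ne rfl
    exact hnone s hsi hsj i hsi.symm (hpos i) hs.symm)
  have hbj := h.card_not_adj_le hdeg (i := j) {i} (by
    intro s hs
    by_contra hsi
    rw [Finset.mem_singleton] at hsi
    have hsj : s ≠ j := by rintro rfl; exact hs.ne rfl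
    exact hnone s hsi hsj j hsj.symm (hpos j) hs.symm)
  obtain ⟨t, ht⟩ : ∃ t, t ∉ (Finset.univ.filter fun k => ¬ H.Adj (y i) (x k)) ∪
      ((Finset.univ.filter fun k => ¬ H.Adj (y j) (x k)) ∪ {i, j}) := by
    by_contra! hc
    have hle := Finset.card_le_card (Finset.eq_univ_iff_forall.2 hc).ge
    have := (Finset.card_union_le (Finset.univ.filter fun k => ¬ H.Adj (y i) (x k))
      ((Finset.univ.filter fun k => ¬ H.Adj (y j) (x k)) ∪ {i, j}))
    have := (Finset.card_union_le (Finset.univ.filter fun k => ¬ H.Adj (y j) (x k)) {i, j})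
    have := Finset.card_le_two (a := i) (b := j)
    rw [Finset.card_univ, Fintype.card_fin] at hle
    simp only [Finset.card_singleton] at hbi hbj
    omega
  simp only [Finset.mem_union, Finset.mem_filter, Finset.mem_univ, true_and, not_or, not_not,
    Finset.mem_insert, Finset.mem_singleton] at ht
  obtain ⟨hit, hjt, hti, htj⟩ := ht
  have hbt := h.card_not_adj_le hdeg (i := t) ∅ (by
    intro s hs
    have hst : s ≠ t := by rintro rfl; exact hs.ne rfl
    exact absurd hs (hnone t hti htj s hst (hpos s)))
  have hor : H.Adj (y t) (x i) ∨ H.Adj (y t) (x j) := by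
    by_contra! hc
    have : ({i, j} : Finset _) ⊆ Finset.univ.filter fun k => ¬ H.Adj (y t) (x k) := by
      simp [Finset.insert_subset_iff, hc]
    have := Finset.card_le_card this
    rw [Finset.card_pair hij] at this
    simp only [Finset.card_empty] at hbt
    omega
  rcases hor with hor | hor
  · obtain ⟨S, hS⟩ := h.pairs.augment_triangle_three hV ((h.mem_iff u).1 hu) hij.symm (Ne.symm htj)
      (Ne.symm hti) hxj hyy.symm hjt hit hor.symm
    exact h.no_packing S hS
  · obtain ⟨S, hS⟩ := h.pairs.augment_triangle_three hV ((h.mem_iff u).1 hu) hij (Ne.symm hti)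
      (Ne.symm htj) hxi hyy hit hjt hor.symm
    exact h.no_packing S hS

theorem exists_isIndepSet_of_card_le (h : IsTightMatching H d m x y U) (hm : m ≤ d + 1)
    (hV : d + 10 ≤ Fintype.card V) (hdV : 2 * d + 4 ≤ Fintype.card V)
    (hdeg : ∀ v, d ≤ H.degree v) :
    ∃ T : Finset V, H.IsIndepSet T ∧ Fintype.card V ≤ T.card + m := by
  have hcard := h.card
  by_cases h0 : ∃ k, degreeIn H U (x k) = 0
  · obtain ⟨k, hk⟩ := h0
    exact h.exists_isIndepSet_of_isolated hm (by omega) (by omega) hdeg hk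
  push Not at h0
  refine h.exists_isIndepSet fun i j hij hadj => ?_
  obtain ⟨u, hu, hxi⟩ := exists_adj_of_degreeIn_pos (Nat.pos_of_ne_zero (h0 i))
  obtain ⟨v, hv, hxj⟩ := exists_adj_of_degreeIn_pos (Nat.pos_of_ne_zero (h0 j))
  obtain rfl := h.eq_of_adj hij hadj hu hv hxi hxj
  have hi1 : degreeIn H U (x i) ≤ 1 :=
    degreeIn_le_one fun w hw hxw => h.eq_of_adj hij hadj hw hu hxw hxj
  have hj1 : degreeIn H U (x j) ≤ 1 :=
    degreeIn_le_one fun w hw hxw => (h.eq_of_adj hij hadj hu hw hxi hxw).symm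
  have hs := h.sum_deficit_le hdeg {i, j}
  rw [Finset.sum_pair hij] at hs
  have hmd : m = d + 1 := by
    by_contra hne
    have := Nat.mul_le_mul_right U.card (by omega : m ≤ d)
    omega
  subst hmd
  rw [Nat.succ_mul] at hs
  exact h.false_of_adj (by omega) (by omega) hdeg hij hadj hu hxi hxj hi1 hj1

end IsTightMatching

section

variable {V : Type*} [Fintype V] [DecidableEq V] {H : SimpleGraph V} [DecidableRel H.Adj] {d : ℕ}

/-- A graph on at least `2 * d + 4` vertices of minimum degree at least `d`, with no clique packing
saving `d + 2`, has a packing and an independent set of complementary sizes. -/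
theorem exists_packing_isIndepSet_of_two_mul_add_four_le
    (hno : ∀ S k, d + 2 ≤ k → ¬ CliquePacking H (Fintype.card V) S k)
    (hdeg : ∀ v, d ≤ H.degree v) (hV : d + 10 ≤ Fintype.card V)
    (hdV : 2 * d + 4 ≤ Fintype.card V) :
    ∃ r S k, ∃ T : Finset V, CliquePacking H r S k ∧ H.IsIndepSet T ∧
      Fintype.card V ≤ T.card + k := by
  classical
  have hex : ∃ m, ¬ ∃ S, CliquePacking H 2 S (m + 1) :=
    ⟨d + 1, fun ⟨S, hS⟩ => hno S _ le_rfl (hS.mono (by omega))⟩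
  obtain ⟨m, hmd, hmax, S, hS⟩ : ∃ m ≤ d + 1, (¬ ∃ S, CliquePacking H 2 S (m + 1)) ∧
      ∃ S, CliquePacking H 2 S m := by
    refine ⟨Nat.find hex, Nat.find_min' hex fun ⟨S, hS⟩ => hno S _ le_rfl (hS.mono (by omega)),
      Nat.find_spec hex, ?_⟩
    rcases hf : Nat.find hex with _ | m
    · exact ⟨∅, .empty⟩
    · exact not_not.1 (Nat.find_min hex (by omega : m < Nat.find hex))
  obtain ⟨x, y, hxy, -⟩ := hS.exists_isMatchingPairs
  set U : Finset V := Finset.univ.filter fun v => ∀ i, v ≠ x i ∧ v ≠ y i with hUdef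
  have hU : ∀ v, v ∈ U ↔ ∀ i, v ≠ x i ∧ v ≠ y i := fun v => by simp [hUdef]
  have hcard := hxy.card_add_card hU
  have hind : ∀ u ∈ U, ∀ v ∈ U, ¬ H.Adj u v := fun u hu v hv huv =>
    hmax (hxy.augment_unmatched le_rfl ((hU u).1 hu) ((hU v).1 hv) huv)
  have hone : ∀ i, ∀ u ∈ U, ∀ v ∈ U, H.Adj (x i) u → H.Adj (y i) v → u = v := by
    intro i u hu v hv hxu hyv
    by_contra huv
    exact hmax (hxy.augment_one le_rfl ((hU u).1 hu) ((hU v).1 hv) huv hxu hyv)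
  have hle : ∀ i, degreeIn H U (x i) + degreeIn H U (y i) ≤ U.card := by
    intro i
    by_cases hx : ∃ u ∈ U, H.Adj (x i) u
    · by_cases hy : ∃ v ∈ U, H.Adj (y i) v
      · obtain ⟨u, hu, hxu⟩ := hx
        obtain ⟨v, hv, hyv⟩ := hy
        have := degreeIn_le_one (U := U) (v := x i) (u := v) fun w hw hxw => hone i w hw v hv hxw hyv
        have := degreeIn_le_one (U := U) (v := y i) (u := u)
          fun w hw hyw => (hone i u hu w hw hxu hyw).symm
        omega
      · push Not at hy
        rw [degreeIn_eq_zero hy]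
        exact degreeIn_le _
    · push Not at hx
      rw [degreeIn_eq_zero hx, zero_add]
      exact degreeIn_le _
  have hnoT : ∀ i, ∀ u ∈ U, H.Adj (x i) u → ¬ H.Adj (y i) u := by
    intro i u hu hxu hyu
    by_cases hm : m = d + 1
    · subst hm
      obtain ⟨S, hS⟩ := hxy.augment_triangle (by omega : 3 ≤ Fintype.card V) ((hU u).1 hu) hxu hyu
      exact hno S _ le_rfl hS
    · have h1 := IsMatchingPairs.mul_le_sum_degreeIn hU hind hdeg
      have hlt : degreeIn H U (x i) + degreeIn H U (y i) < U.card := by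
        have := degreeIn_le_one (U := U) (v := x i) (u := u)
          fun w hw hxw => hone i w hw u hu hxw hyu
        have := degreeIn_le_one (U := U) (v := y i) (u := u)
          fun w hw hyw => (hone i u hu w hw hxu hyw).symm
        omega
      have h2 := Finset.sum_lt_sum (fun i _ => hle i) ⟨i, Finset.mem_univ i, hlt⟩
      rw [Finset.sum_const, Finset.card_univ, Fintype.card_fin, smul_eq_mul] at h2
      have := Nat.mul_le_mul_right U.card (by omega : m ≤ d)
      omega
  let p : Fin m → Prop := fun i => ∃ u ∈ U, H.Adj (y i) u
  have htight : IsTightMatching H d m (fun i => if p i then y i else x i)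
      (fun i => if p i then x i else y i) U :=
    { pairs := hxy.swap p
      mem_iff := fun v => by
        rw [hU]
        refine forall_congr' fun i => ?_
        by_cases hi : p i <;> simp [hi, and_comm]
      card := hcard
      indep := hind
      not_adj := fun u hu i hadj => by
        by_cases hi : p i
        · rw [if_pos hi] at hadj
          obtain ⟨v, hv, hyv⟩ := hi
          obtain rfl := hone i u hu v hv hadj.symm hyv
          exact hnoT i u hu hadj.symm hyv
        · rw [if_neg hi] at hadj
          exact hi ⟨u, hu, hadj.symm⟩
      maximum := fun S hS => hmax ⟨S, hS⟩
      no_packing := fun S => hno S _ le_rfl }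
  obtain ⟨T, hT, hTc⟩ := htight.exists_isIndepSet_of_card_le hmd hV hdV hdeg
  exact ⟨2, S, m, T, hS, hT, hTc⟩

theorem CliquePacking.exists_insert_adj {L S : Finset V} {r k : ℕ}
    (hS : CliquePacking H r S k) (hr : 2 ≤ r) (hLS : L ⊆ S)
    (hout : ∀ v ∉ L, 6 ≤ (H.neighborFinset v \ L).card) {v : V} (hv : v ∉ L)
    (hc : (S \ L).card ≤ 4) :
    ∃ S', CliquePacking H r S' (k + 1) ∧ L ⊆ S' ∧ (S' \ L).card ≤ (S \ L).card + 2 := by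
  have step : ∀ v ∉ L, ∃ w ∉ S, H.Adj v w := by
    intro v hv
    have h1 := Finset.le_card_sdiff (S \ L) (H.neighborFinset v \ L)
    have h2 := hout v hv
    obtain ⟨w, hw⟩ := Finset.card_pos.1 (by omega : 0 < ((H.neighborFinset v \ L) \ (S \ L)).card)
    simp only [Finset.mem_sdiff, SimpleGraph.mem_neighborFinset] at hw
    exact ⟨w, fun h => hw.2 ⟨h, hw.1.2⟩, hw.1.1⟩
  obtain ⟨a, ha, -⟩ := step v hv
  obtain ⟨b, hb, hab⟩ := step a fun h => ha (hLS h)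
  refine ⟨{a, b} ∪ S, hS.insert_pair hr hab ha hb, hLS.trans Finset.subset_union_right, ?_⟩
  rw [Finset.union_sdiff_distrib]
  refine (Finset.card_union_le _ _).trans ?_
  have := (Finset.card_le_card (Finset.sdiff_subset (s := {a, b}) (t := L))).trans Finset.card_le_two
  omega

/-- A clique of size at least `d` such that every other vertex has at most one neighbour in it
extends to a packing saving `d + 2`. -/
theorem exists_packing_of_isClique (hdeg : ∀ v, d ≤ H.degree v) (hV : d + 10 ≤ Fintype.card V)
    (hd : 7 ≤ d) {L : Finset V} (hL : H.IsClique L) (hdL : d ≤ L.card)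
    (hone : ∀ v ∉ L, ∀ a ∈ L, ∀ b ∈ L, H.Adj v a → H.Adj v b → a = b) :
    ∃ S k, d + 2 ≤ k ∧ CliquePacking H (Fintype.card V) S k := by
  have hne : L.Nonempty := Finset.card_pos.1 (by omega)
  have hpack := CliquePacking.union hL hne (Finset.card_le_univ L) (Finset.disjoint_empty_right L)
    .empty
  rw [Finset.union_empty, zero_add] at hpack
  by_cases hLV : ∀ v, v ∈ L
  · rw [Finset.eq_univ_iff_forall.2 hLV, Finset.card_univ] at hpack
    exact ⟨_, _, by omega, hpack⟩
  push Not at hLV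
  obtain ⟨v, hv⟩ := hLV
  have hout : ∀ v ∉ L, 6 ≤ (H.neighborFinset v \ L).card := by
    intro v hv
    have h1 := Finset.card_sdiff_add_card_inter (H.neighborFinset v) L
    have h2 : (H.neighborFinset v ∩ L).card ≤ 1 := Finset.card_le_one.2 fun a ha b hb => by
      simp only [Finset.mem_inter, SimpleGraph.mem_neighborFinset] at ha hb
      exact hone v hv a ha.2 b hb.2 ha.1 hb.1
    have h3 := hdeg v
    rw [← SimpleGraph.card_neighborFinset_eq_degree] at h3
    omega
  have h0 : (L \ L).card = 0 := by simp
  obtain ⟨S₁, hS₁, hL₁, hc₁⟩ := hpack.exists_insert_adj (by omega) subset_rfl hout hv (by omega)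
  obtain ⟨S₂, hS₂, hL₂, hc₂⟩ := hS₁.exists_insert_adj (by omega) hL₁ hout hv (by omega)
  obtain ⟨S₃, hS₃, -, -⟩ := hS₂.exists_insert_adj (by omega) hL₂ hout hv (by omega)
  exact ⟨_, _, by omega, hS₃⟩

/-- In a small graph, a set of at least three vertices such that every other vertex has at most one
neighbour in it is large. -/
theorem le_card_of_adj_eq (hdeg : ∀ v, d ≤ H.degree v) (hdV : Fintype.card V ≤ 2 * d + 3)
    (hd : 7 ≤ d) {L : Finset V} (hL3 : 3 ≤ L.card)
    (hone : ∀ v ∉ L, ∀ a ∈ L, ∀ b ∈ L, H.Adj v a → H.Adj v b → a = b) : d ≤ L.card := by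
  by_contra! hlt
  have hbig : ∀ a ∈ L, d + 1 - L.card ≤ (H.neighborFinset a \ L).card := by
    intro a ha
    have h1 := Finset.card_sdiff_add_card_inter (H.neighborFinset a) L
    have h2 : H.neighborFinset a ∩ L ⊆ L.erase a := by
      intro b hb
      simp only [Finset.mem_inter, SimpleGraph.mem_neighborFinset] at hb
      exact Finset.mem_erase.2 ⟨hb.1.ne.symm, hb.2⟩
    have h2 := Finset.card_le_card h2
    rw [Finset.card_erase_of_mem ha] at h2
    have h3 := hdeg a
    rw [← SimpleGraph.card_neighborFinset_eq_degree] at h3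
    omega
  have hdisj : ∀ a ∈ L, ∀ b ∈ L, a ≠ b →
      Disjoint (H.neighborFinset a \ L) (H.neighborFinset b \ L) := by
    intro a ha b hb hab
    rw [Finset.disjoint_left]
    intro v hva hvb
    simp only [Finset.mem_sdiff, SimpleGraph.mem_neighborFinset] at hva hvb
    exact hab (hone v hva.2 a ha b hb hva.1.symm hvb.1.symm)
  have h1 := Finset.card_biUnion hdisj
  have h2 := Finset.card_nsmul_le_sum L _ _ hbig
  have h3 : (L.biUnion fun a => H.neighborFinset a \ L).card ≤ Lᶜ.card := by
    refine Finset.card_le_card (Finset.biUnion_subset.2 fun a _ v hv => ?_)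
    exact Finset.mem_compl.2 (Finset.mem_sdiff.1 hv).2
  have h4 := Finset.card_add_card_compl L
  rw [smul_eq_mul] at h2
  obtain ⟨s, hs⟩ := Nat.exists_eq_add_of_le (show L.card + 1 ≤ d by omega)
  obtain ⟨t, ht⟩ := Nat.exists_eq_add_of_le hL3
  rw [show d + 1 - L.card = s + 2 by omega, ht] at h2
  nlinarith

/-- A small graph whose vertices split into two independent sets has a matching saturating the
smaller side. -/
theorem exists_packing_of_isIndepSet (hdeg : ∀ v, d ≤ H.degree v)
    (hdV : Fintype.card V ≤ 2 * d + 3) (hd : 1 ≤ d) {X : Finset V} (hX : H.IsIndepSet X)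
    (hXc : H.IsIndepSet (Xᶜ : Finset V)) (hle : X.card ≤ Xᶜ.card) :
    ∃ S, CliquePacking H 2 S X.card := by
  have hcard := Finset.card_add_card_compl X
  obtain ⟨f, hf, hadj⟩ := (Finset.all_card_le_biUnion_card_iff_exists_injective
    fun a : X => H.neighborFinset a).1 (by
      intro s
      obtain rfl | ⟨a, ha⟩ := s.eq_empty_or_nonempty
      · simp
      have hs : s.card ≤ X.card := by simpa using Finset.card_le_univ s
      have h1 : d ≤ (s.biUnion fun a : X => H.neighborFinset a).card := by
        refine (hdeg a).trans ?_
        rw [← SimpleGraph.card_neighborFinset_eq_degree]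
        exact Finset.card_le_card (Finset.subset_biUnion_of_mem
          (fun a : X => H.neighborFinset (a : V)) ha)
      by_cases hsd : s.card ≤ d
      · omega
      have hsu : s = Finset.univ := by
        rw [← Finset.card_eq_iff_eq_univ, Fintype.card_coe]
        omega
      refine hs.trans (hle.trans (Finset.card_le_card fun v hv => ?_))
      obtain ⟨w, hw⟩ : ∃ w, H.Adj v w := by
        rw [← H.degree_pos_iff_exists_adj]
        exact hd.trans (hdeg v)
      have hwX : w ∈ X := by
        by_contra hwX
        exact hXc hv (by simpa using hwX) hw.ne hw
      rw [hsu, Finset.mem_biUnion]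
      exact ⟨⟨w, hwX⟩, Finset.mem_univ _, by simpa using hw.symm⟩)
  have hadj' : ∀ a : X, H.Adj a (f a) := fun a => by simpa using hadj a
  have hfX : ∀ a, f a ∉ X := fun a h => hX a.2 h (hadj' a).ne (hadj' a)
  have hM : IsMatchingPairs H (fun a : X => (a : V)) f :=
    ⟨hadj', fun a b hab => ⟨fun h => hab (Subtype.ext h), fun h => hfX b (h ▸ a.2),
      fun h => hfX a (h ▸ b.2), fun h => hab (hf h)⟩⟩
  have := hM.cliquePacking le_rfl Finset.univ
  rw [Finset.card_univ, Fintype.card_coe] at this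
  exact ⟨_, this⟩

theorem exists_packing_isIndepSet_of_card_le
    (hdia : ∀ a b u v, H.Adj a b → H.Adj a u → H.Adj b u → H.Adj a v → H.Adj b v → u ≠ v →
      H.Adj u v)
    (hno : ∀ S k, d + 2 ≤ k → ¬ CliquePacking H (Fintype.card V) S k)
    (hdeg : ∀ v, d ≤ H.degree v) (hV : d + 10 ≤ Fintype.card V)
    (hdV : Fintype.card V ≤ 2 * d + 3) :
    ∃ r S k, ∃ T : Finset V, CliquePacking H r S k ∧ H.IsIndepSet T ∧
      Fintype.card V ≤ T.card + k := by
  classical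
  have hd : 7 ≤ d := by omega
  have hfree : H.CliqueFree 3 := by
    by_contra hnf
    obtain ⟨L, hL⟩ := H.exists_isNClique_cliqueNum
    have h3 : 3 ≤ L.card := by
      simp only [SimpleGraph.CliqueFree, not_forall, not_not] at hnf
      obtain ⟨t, ht⟩ := hnf
      have := ht.isClique.card_le_cliqueNum
      rw [ht.card_eq] at this
      exact hL.card_eq ▸ this
    have hone : ∀ v ∉ L, ∀ a ∈ L, ∀ b ∈ L, H.Adj v a → H.Adj v b → a = b := by
      intro v hv a ha b hb hva hvb
      by_contra hab
      have hcl : H.IsClique (insert v L : Finset V) := by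
        rw [Finset.coe_insert, SimpleGraph.isClique_insert]
        refine ⟨hL.isClique, fun c hc hvc => ?_⟩
        by_cases hca : c = a
        · exact hca ▸ hva
        by_cases hcb : c = b
        · exact hcb ▸ hvb
        exact hdia a b v c (hL.isClique ha hb hab) hva.symm hvb.symm
          (hL.isClique ha hc (Ne.symm hca)) (hL.isClique hb hc (Ne.symm hcb)) hvc
      have := hcl.card_le_cliqueNum
      rw [Finset.card_insert_of_notMem hv, hL.card_eq] at this
      omega
    obtain ⟨S, k, hk, hS⟩ := exists_packing_of_isClique hdeg hV hd hL.isClique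
      (le_card_of_adj_eq hdeg hdV hd h3 hone) hone
    exact hno S k hk hS
  have : Nonempty V := Fintype.card_pos_iff.1 (by omega)
  have hmin : d ≤ H.minDegree := H.le_minDegree_of_forall_le_degree _ hdeg
  obtain ⟨c⟩ := SimpleGraph.colorable_of_cliqueFree_lt_minDegree (r := 2) hfree (by omega)
  have hind : ∀ i : Fin 2, H.IsIndepSet (Finset.univ.filter fun v => c v = i : Finset V) := by
    intro i a ha b hb _ hab
    simp only [Finset.coe_filter, Finset.mem_univ, true_and, Set.mem_ofPred_eq] at ha hb
    exact c.valid hab (ha.trans hb.symm)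
  have hcompl : (Finset.univ.filter fun v => c v = 0)ᶜ = Finset.univ.filter fun v => c v = 1 := by
    ext v
    simp only [Finset.mem_compl, Finset.mem_filter, Finset.mem_univ, true_and]
    omega
  obtain ⟨X, hX, hXc, hle⟩ : ∃ X : Finset V, H.IsIndepSet X ∧ H.IsIndepSet (Xᶜ : Finset V) ∧
      X.card ≤ Xᶜ.card := by
    rcases le_total (Finset.univ.filter fun v => c v = 0).card
      (Finset.univ.filter fun v => c v = 1).card with h | h
    · exact ⟨_, hind 0, hcompl ▸ hind 1, hcompl ▸ h⟩
    · refine ⟨_, hind 1, ?_, ?_⟩ <;> rw [← hcompl, compl_compl]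
      · exact hind 0
      · rwa [hcompl]
  obtain ⟨S, hS⟩ := exists_packing_of_isIndepSet hdeg hdV (by omega) hX hXc hle
  exact ⟨2, S, X.card, Xᶜ, hS, hXc, by rw [add_comm, Finset.card_add_card_compl]⟩

end

/-- In the complement of a `graphR`-free graph, two distinct common neighbours of an edge are
adjacent. -/
theorem adj_compl_of_indFree_graphR {V : Type*} {G : SimpleGraph V} (h : IndFree graphR G)
    (a b u v : V) (hab : Gᶜ.Adj a b) (hau : Gᶜ.Adj a u) (hbu : Gᶜ.Adj b u) (hav : Gᶜ.Adj a v)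
    (hbv : Gᶜ.Adj b v) (huv : u ≠ v) : Gᶜ.Adj u v := by
  by_contra hn
  simp only [SimpleGraph.compl_adj] at hab hau hbu hav hbv hn
  have hadj : G.Adj u v := by tauto
  refine h.elim ⟨⟨![u, v, a, b], ?_⟩, ?_⟩
  · intro i j hij
    fin_cases i <;> fin_cases j <;> simp_all [eq_comm]
  · intro i j
    change G.Adj (![u, v, a, b] i) (![u, v, a, b] j) ↔ _
    fin_cases i <;> fin_cases j <;> simp_all [graphR, SimpleGraph.adj_comm]

/-- Borodin–Kostochka for `(K₂ ∪ 2K₁)`-free graphs: if `Δ(G) ≥ 9` and `G` has no induced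
subgraph isomorphic to `K₂ ∪ 2K₁`, then `χ(G) ≤ max {ω(G), Δ(G) - 1}`. -/
theorem borodin_kostochka_K2_union_2K1_free {V : Type*} [Fintype V] (G : SimpleGraph V)
    (hΔ : 9 ≤ maxDeg G) (hfree : IndFree graphR G) :
    G.chromaticNumber ≤ ((max G.cliqueNum (maxDeg G - 1) : ℕ) : ℕ∞) := by
  classical
  have hmax : maxDeg G = G.maxDegree := by
    unfold maxDeg
    congr
  rw [hmax] at hΔ ⊢
  have : Nonempty V := by
    by_contra hV
    rw [not_nonempty_iff] at hV
    rw [SimpleGraph.maxDegree_of_subsingleton] at hΔ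
    omega
  have hlt := G.maxDegree_lt_card_verts
  obtain ⟨d, hd⟩ := Nat.exists_eq_add_of_lt hlt
  have hdeg : ∀ v, d ≤ Gᶜ.degree v := fun v => by
    rw [SimpleGraph.degree_compl]
    have := G.degree_le_maxDegree v
    omega
  by_cases hno : ∃ S k, d + 2 ≤ k ∧ CliquePacking Gᶜ (Fintype.card V) S k
  · obtain ⟨S, k, hk, hS⟩ := hno
    have hcol := hS.colorable_compl
    rw [compl_compl] at hcol
    refine hcol.chromaticNumber_le.trans (Nat.cast_le.2 (le_max_of_le_right ?_))
    omega
  · push Not at hno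
    obtain ⟨r, S, k, T, hS, hT, hTk⟩ : ∃ r S k, ∃ T : Finset V, CliquePacking Gᶜ r S k ∧
        Gᶜ.IsIndepSet T ∧ Fintype.card V ≤ T.card + k := by
      rcases le_or_gt (2 * d + 4) (Fintype.card V) with hdV | hdV
      · exact exists_packing_isIndepSet_of_two_mul_add_four_le hno hdeg (by omega) hdV
      · exact exists_packing_isIndepSet_of_card_le (adj_compl_of_indFree_graphR hfree) hno hdeg
          (by omega) (by omega)
    have hcol := hS.colorable_compl
    rw [compl_compl] at hcol
    rw [SimpleGraph.isIndepSet_compl] at hT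
    have := hT.card_le_cliqueNum
    refine hcol.chromaticNumber_le.trans (Nat.cast_le.2 (le_max_of_le_left ?_))
    omega
end

section
/- Let G be a finite simple graph that is (K₂ ∪ 2K₁)-free, let c be a proper vertex coloring of G, and let u be a vertex of G. If some vertex in the neighborhood N(u) receives color i under c, then at most one vertex outside the closed neighborhood N[u] = N(u) ∪ {u} receives color i under c. -/
open SimpleGraph

/-- In a `(K₂ ∪ 2K₁)`-free graph, two vertices that are adjacent neither to each other nor to
an end of a given edge coincide. -/
theorem IndFree.eq_of_not_adj {V : Type*} {G : SimpleGraph V} (hfree : IndFree graphR G)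
    {a b v w : V} (hab : G.Adj a b) (hav : ¬ G.Adj a v) (haw : ¬ G.Adj a w)
    (hbv : ¬ G.Adj b v) (hbw : ¬ G.Adj b w) (hvw : ¬ G.Adj v w) : v = w := by
  by_contra hne
  have hab' : a ≠ b := hab.ne
  have hva : a ≠ v := by rintro rfl; exact hbv hab.symm
  have hwa : a ≠ w := by rintro rfl; exact hbw hab.symm
  have hvb : b ≠ v := by rintro rfl; exact hav hab
  have hwb : b ≠ w := by rintro rfl; exact haw hab
  refine hfree.false ⟨⟨![a, b, v, w], ?_⟩, ?_⟩
  · intro p q hpq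
    fin_cases p <;> fin_cases q <;> simp_all [eq_comm]
  · intro p q
    change G.Adj (![a, b, v, w] p) (![a, b, v, w] q) ↔ graphR.Adj p q
    fin_cases p <;> fin_cases q <;> simp [graphR, mt G.adj_symm hav, mt G.adj_symm haw,
      mt G.adj_symm hbv, mt G.adj_symm hbw, mt G.adj_symm hvw, hab.symm, *]

/-- In a `(K₂ ∪ 2K₁)`-free graph with a proper coloring `c`, if some neighbor of `u` receives
color `i`, then at most one vertex outside the closed neighborhood `N[u]` receives color `i`. -/
theorem at_most_one_repeat_outside_closed_nbhd {V : Type*} [Fintype V] (G : SimpleGraph V)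
    (hfree : IndFree graphR G) {α : Type*} (c : G.Coloring α) (u : V) (i : α)
    (h : ∃ x ∈ G.neighborSet u, c x = i) :
    ∀ v w : V, v ∉ insert u (G.neighborSet u) → w ∉ insert u (G.neighborSet u) →
      c v = i → c w = i → v = w := by
  obtain ⟨x, hux, hx⟩ := h
  intro v w hv hw hcv hcw
  have not_adj {y z : V} (hy : c y = i) (hz : c z = i) : ¬ G.Adj y z :=
    fun hyz => c.valid hyz (hy.trans hz.symm)
  exact hfree.eq_of_not_adj hux (fun h => hv (Or.inr h)) (fun h => hw (Or.inr h))
    (not_adj hx hcv) (not_adj hx hcw) (not_adj hcv hcw)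
end
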